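/- Let (g,c,n) be a v-admissible triplet with g ≥ 5. Then g/4 ≤ A(g,c,n), and moreover: (i) if 2g-2 ≤ c < 3g-4 with c = 2g-2+s where 0 ≤ s ≤ g-3, then A(g,c,n) ≤ (g+2+s)/4; (ii) if r ≥ 1 is an integer, g is even and c = 2g-2+r(g-2), then A(g,c,n) ≤ (g+2)/4; (iii) if r ≥ 1 is an integer, g is odd and 2g-2+r(g-2) ≤ c ≤ 2g-1+r(g-2), then A(g,c,n) ≤ (g+3)/4; (iv) if r ≥ 1 and s ≥ 0 are integers, g is even and 2g-2+r(g-2) < c ≤ 2g-2+r(g-2)+2(r+1)(s+1), then A(g,c,n) ≤ (g+4+2s)/4; (v) if r ≥ 1 and s ≥ 0 are integers, g is odd and 2g-1+r(g-2) < c ≤ 2g-2+r(g-2)+2(r+1)(s+1), then A(g,c,n) ≤ (g+5+2s)/4. -/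

import Mathlib

open SimpleGraph Set

/-- Auxiliary distance on representations of points of the metric graph:
a point is represented by `(u, v, t)` with `u, v` adjacent and `t ∈ [0,1]`,
meaning the point on the edge `[u,v]` at distance `t` from `u`. -/
noncomputable def mgDistAux {V : Type} [Fintype V] [DecidableEq V] (G : SimpleGraph V)
    (p q : V × V × ℝ) : ℝ :=
  min
    (min (if p.1 = q.1 ∧ p.2.1 = q.2.1 then |p.2.2 - q.2.2| else (Fintype.card V : ℝ) + 1)
         (if p.1 = q.2.1 ∧ p.2.1 = q.1 then |p.2.2 - (1 - q.2.2)| else (Fintype.card V : ℝ) + 1))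
    (min (min (p.2.2 + (G.dist p.1 q.1 : ℝ) + q.2.2)
              (p.2.2 + (G.dist p.1 q.2.1 : ℝ) + (1 - q.2.2)))
         (min ((1 - p.2.2) + (G.dist p.2.1 q.1 : ℝ) + q.2.2)
              ((1 - p.2.2) + (G.dist p.2.1 q.2.1 : ℝ) + (1 - q.2.2))))

/-- The points of the metric graph associated to a simple graph `G`:
the vertices together with the interior points of the edges. -/
def MGPoint {V : Type} (G : SimpleGraph V) : Type :=
  {p : V × V × ℝ // G.Adj p.1 p.2.1 ∧ p.2.2 ∈ Set.Icc (0 : ℝ) 1}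

/-- The shortest-path distance on the metric graph associated to `G`
(every edge has length 1). -/
noncomputable def mgDist {V : Type} [Fintype V] [DecidableEq V] (G : SimpleGraph V)
    (p q : MGPoint G) : ℝ := mgDistAux G p.1 q.1

/-- Distance from a vertex `v` to a point of the metric graph. -/
noncomputable def mgVDist {V : Type} [Fintype V] [DecidableEq V] (G : SimpleGraph V)
    (v : V) (x : MGPoint G) : ℝ :=
  min ((G.dist v x.1.1 : ℝ) + x.1.2.2) ((G.dist v x.1.2.1 : ℝ) + (1 - x.1.2.2))

/-- `γ` restricted to `[a,b]` is a geodesic in the metric graph of `G`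
(an arc-length parametrization realizing distances). -/
def IsMGGeodesic {V : Type} [Fintype V] [DecidableEq V] (G : SimpleGraph V)
    (a b : ℝ) (γ : ℝ → MGPoint G) : Prop :=
  a ≤ b ∧ ∀ s ∈ Set.Icc a b, ∀ t ∈ Set.Icc a b, mgDist G (γ s) (γ t) = |s - t|

/-- A geodesic triangle in the metric graph of `G`: three geodesic sides whose
endpoints match cyclically (distance `0` means equality of points). -/
structure MGTriangle {V : Type} [Fintype V] [DecidableEq V] (G : SimpleGraph V) where
  a1 : ℝ
  b1 : ℝ
  a2 : ℝ
  b2 : ℝ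
  a3 : ℝ
  b3 : ℝ
  g1 : ℝ → MGPoint G
  g2 : ℝ → MGPoint G
  g3 : ℝ → MGPoint G
  h1 : IsMGGeodesic G a1 b1 g1
  h2 : IsMGGeodesic G a2 b2 g2
  h3 : IsMGGeodesic G a3 b3 g3
  glue1 : mgDist G (g1 b1) (g2 a2) = 0
  glue2 : mgDist G (g2 b2) (g3 a3) = 0
  glue3 : mgDist G (g3 b3) (g1 a1) = 0

/-- The sharp thin constant `δ(T)` of a geodesic triangle: the infimum of the
`d ≥ 0` such that each side is contained in the `d`-neighborhood of the union of
the other two sides. -/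
noncomputable def triangleDelta {V : Type} [Fintype V] [DecidableEq V] {G : SimpleGraph V}
    (T : MGTriangle G) : ℝ :=
  sInf {d : ℝ | 0 ≤ d ∧
    (∀ s ∈ Set.Icc T.a1 T.b1,
      (∃ t ∈ Set.Icc T.a2 T.b2, mgDist G (T.g1 s) (T.g2 t) ≤ d) ∨
      (∃ t ∈ Set.Icc T.a3 T.b3, mgDist G (T.g1 s) (T.g3 t) ≤ d)) ∧
    (∀ s ∈ Set.Icc T.a2 T.b2,
      (∃ t ∈ Set.Icc T.a1 T.b1, mgDist G (T.g2 s) (T.g1 t) ≤ d) ∨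
      (∃ t ∈ Set.Icc T.a3 T.b3, mgDist G (T.g2 s) (T.g3 t) ≤ d)) ∧
    (∀ s ∈ Set.Icc T.a3 T.b3,
      (∃ t ∈ Set.Icc T.a1 T.b1, mgDist G (T.g3 s) (T.g1 t) ≤ d) ∨
      (∃ t ∈ Set.Icc T.a2 T.b2, mgDist G (T.g3 s) (T.g2 t) ≤ d))}

/-- The hyperbolicity constant `δ(G)`: the supremum of `δ(T)` over all geodesic
triangles `T` in the metric graph of `G`. -/
noncomputable def hypDelta {V : Type} [Fintype V] [DecidableEq V] (G : SimpleGraph V) : ℝ :=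
  sSup {d : ℝ | ∃ T : MGTriangle G, d = triangleDelta T}

/-- The circumference of `G`: the length of a longest cycle. -/
noncomputable def circumference {V : Type} (G : SimpleGraph V) : ℕ :=
  sSup {n : ℕ | ∃ (a : V) (w : G.Walk a a), w.IsCycle ∧ w.length = n}

/-- `G` belongs to the class `𝒢(g,c,n)` of (connected) graphs with girth `g`,
circumference `c` and `n` vertices (vertex set `Fin n`). -/
def memGclass (g c : ℕ) {n : ℕ} (G : SimpleGraph (Fin n)) : Prop :=
  G.Connected ∧ G.girth = g ∧ circumference G = c

/-- `A(g,c,n) = min {δ(G) : G ∈ 𝒢(g,c,n)}`. -/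
noncomputable def Agcn (g c n : ℕ) : ℝ :=
  sInf {d : ℝ | ∃ G : SimpleGraph (Fin n), memGclass g c G ∧ d = hypDelta G}

/-- `B(g,c,n) = max {δ(G) : G ∈ 𝒢(g,c,n)}`. -/
noncomputable def Bgcn (g c n : ℕ) : ℝ :=
  sSup {d : ℝ | ∃ G : SimpleGraph (Fin n), memGclass g c G ∧ d = hypDelta G}

/-- `G` belongs to the class `ℋ(g,c,m)` of (connected) graphs with girth `g`,
circumference `c` and `m` edges. -/
def memHclass (g c m : ℕ) {k : ℕ} (G : SimpleGraph (Fin k)) : Prop :=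
  G.Connected ∧ G.girth = g ∧ circumference G = c ∧ G.edgeSet.ncard = m

/-- `α(g,c,m) = min {δ(G) : G ∈ ℋ(g,c,m)}`. -/
noncomputable def alphagcm (g c m : ℕ) : ℝ :=
  sInf {d : ℝ | ∃ (k : ℕ) (G : SimpleGraph (Fin k)), memHclass g c m G ∧ d = hypDelta G}

/-- `β(g,c,m) = max {δ(G) : G ∈ ℋ(g,c,m)}`. -/
noncomputable def betagcm (g c m : ℕ) : ℝ :=
  sSup {d : ℝ | ∃ (k : ℕ) (G : SimpleGraph (Fin k)), memHclass g c m G ∧ d = hypDelta G}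


set_option linter.unusedSectionVars false

section Generic
variable {V : Type} [Fintype V] [DecidableEq V] {G : SimpleGraph V}

lemma mg_dist_lt_card (hG : G.Connected) (u v : V) : (G.dist u v : ℝ) + 1 ≤ Fintype.card V := by
  obtain ⟨p, hp, hl⟩ := hG.exists_path_of_dist u v
  have := hp.length_lt
  rw [hl] at this
  exact_mod_cast this

/-- the value of `mgDist` is one of the six expected ones -/
lemma mgDist_cases (hG : G.Connected) (p q : MGPoint G) :
    (p.1.1 = q.1.1 ∧ p.1.2.1 = q.1.2.1 ∧ mgDist G p q = |p.1.2.2 - q.1.2.2|) ∨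
    (p.1.1 = q.1.2.1 ∧ p.1.2.1 = q.1.1 ∧ mgDist G p q = |p.1.2.2 - (1 - q.1.2.2)|) ∨
    mgDist G p q = p.1.2.2 + (G.dist p.1.1 q.1.1 : ℝ) + q.1.2.2 ∨
    mgDist G p q = p.1.2.2 + (G.dist p.1.1 q.1.2.1 : ℝ) + (1 - q.1.2.2) ∨
    mgDist G p q = (1 - p.1.2.2) + (G.dist p.1.2.1 q.1.1 : ℝ) + q.1.2.2 ∨
    mgDist G p q = (1 - p.1.2.2) + (G.dist p.1.2.1 q.1.2.1 : ℝ) + (1 - q.1.2.2) := by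
  obtain ⟨⟨a, b, t⟩, hab, ht0, ht1⟩ := p
  obtain ⟨⟨c, d, s⟩, hcd, hs0, hs1⟩ := q
  have h1 := mg_dist_lt_card hG a c
  have h2 := mg_dist_lt_card hG b d
  simp only at *
  simp only [mgDist, mgDistAux]
  set N : ℝ := (Fintype.card V : ℝ)
  set e1 := if a = c ∧ b = d then |t - s| else N + 1 with he1
  set e2 := if a = d ∧ b = c then |t - (1 - s)| else N + 1 with he2
  set f1 := t + (G.dist a c : ℝ) + s
  set f2 := t + (G.dist a d : ℝ) + (1 - s)
  set f3 := (1 - t) + (G.dist b c : ℝ) + s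
  set f4 := (1 - t) + (G.dist b d : ℝ) + (1 - s)
  have hmin : min (min e1 e2) (min (min f1 f2) (min f3 f4)) < N + 1 := by
    by_contra hcon
    push Not at hcon
    simp only [le_min_iff] at hcon
    obtain ⟨_, ⟨g1, _⟩, _, g4⟩ := hcon
    simp only [f1, f4] at g1 g4
    linarith
  rcases min_choice (min e1 e2) (min (min f1 f2) (min f3 f4)) with h | h
  · rw [h] at hmin ⊢
    rcases min_choice e1 e2 with h' | h'
    · rw [h'] at hmin ⊢
      rw [he1] at hmin ⊢
      split_ifs at hmin ⊢ with hc
      · exact Or.inl ⟨hc.1, hc.2, rfl⟩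
      · exact absurd hmin (lt_irrefl _)
    · rw [h'] at hmin ⊢
      rw [he2] at hmin ⊢
      split_ifs at hmin ⊢ with hc
      · exact Or.inr (Or.inl ⟨hc.1, hc.2, rfl⟩)
      · exact absurd hmin (lt_irrefl _)
  · rw [h]
    right; right
    rcases min_choice (min f1 f2) (min f3 f4) with h' | h' <;> rw [h']
    · rcases min_choice f1 f2 with h'' | h'' <;> rw [h''] <;> simp
    · rcases min_choice f3 f4 with h'' | h'' <;> rw [h''] <;> simp

lemma mgDist_le1 (p q : MGPoint G) :
    mgDist G p q ≤ p.1.2.2 + (G.dist p.1.1 q.1.1 : ℝ) + q.1.2.2 := by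
  simp [mgDist, mgDistAux]
lemma mgDist_le2 (p q : MGPoint G) :
    mgDist G p q ≤ p.1.2.2 + (G.dist p.1.1 q.1.2.1 : ℝ) + (1 - q.1.2.2) := by
  simp only [mgDist, mgDistAux]
  exact (min_le_right _ _).trans ((min_le_left _ _).trans (min_le_right _ _))
lemma mgDist_le3 (p q : MGPoint G) :
    mgDist G p q ≤ (1 - p.1.2.2) + (G.dist p.1.2.1 q.1.1 : ℝ) + q.1.2.2 := by
  simp only [mgDist, mgDistAux]
  exact (min_le_right _ _).trans ((min_le_right _ _).trans (min_le_left _ _))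
lemma mgDist_le4 (p q : MGPoint G) :
    mgDist G p q ≤ (1 - p.1.2.2) + (G.dist p.1.2.1 q.1.2.1 : ℝ) + (1 - q.1.2.2) := by
  simp only [mgDist, mgDistAux]
  exact (min_le_right _ _).trans ((min_le_right _ _).trans (min_le_right _ _))
lemma mgDist_le5 (p q : MGPoint G) (h1 : p.1.1 = q.1.1) (h2 : p.1.2.1 = q.1.2.1) :
    mgDist G p q ≤ |p.1.2.2 - q.1.2.2| := by
  simp only [mgDist, mgDistAux]
  refine (min_le_left _ _).trans ((min_le_left _ _).trans ?_)
  rw [if_pos ⟨h1, h2⟩]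
lemma mgDist_le6 (p q : MGPoint G) (h1 : p.1.1 = q.1.2.1) (h2 : p.1.2.1 = q.1.1) :
    mgDist G p q ≤ |p.1.2.2 - (1 - q.1.2.2)| := by
  simp only [mgDist, mgDistAux]
  refine (min_le_left _ _).trans ((min_le_right _ _).trans ?_)
  rw [if_pos ⟨h1, h2⟩]

lemma mgDist_nonneg (hG : G.Connected) (p q : MGPoint G) : 0 ≤ mgDist G p q := by
  have := p.2.2.1; have := p.2.2.2; have := q.2.2.1; have := q.2.2.2
  have : ∀ u v, (0 : ℝ) ≤ G.dist u v := fun u v => Nat.cast_nonneg _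
  rcases mgDist_cases hG p q with ⟨_, _, h⟩ | ⟨_, _, h⟩ | h | h | h | h <;> rw [h]
  · exact abs_nonneg _
  · exact abs_nonneg _
  all_goals
    have := this
    first
    | nlinarith [this p.1.1 q.1.1, this p.1.1 q.1.2.1, this p.1.2.1 q.1.1, this p.1.2.1 q.1.2.1]

lemma mgDist_comm_le (hG : G.Connected) (p q : MGPoint G) : mgDist G p q ≤ mgDist G q p := by
  rcases mgDist_cases hG q p with ⟨h1, h2, h⟩ | ⟨h1, h2, h⟩ | h | h | h | h <;> rw [h]
  · rw [abs_sub_comm]; exact mgDist_le5 p q h1.symm h2.symm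
  · refine (mgDist_le6 p q h2.symm h1.symm).trans (le_of_eq ?_)
    congr 1; ring
  · have := mgDist_le1 p q; rw [SimpleGraph.dist_comm] at this; linarith
  · have := mgDist_le3 p q; rw [SimpleGraph.dist_comm] at this; linarith
  · have := mgDist_le2 p q; rw [SimpleGraph.dist_comm] at this; linarith
  · have := mgDist_le4 p q; rw [SimpleGraph.dist_comm] at this; linarith

lemma mgDist_comm (hG : G.Connected) (p q : MGPoint G) : mgDist G p q = mgDist G q p :=
  le_antisymm (mgDist_comm_le hG p q) (mgDist_comm_le hG q p)

/-- linear interpolation of a vertex function -/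
noncomputable def mgInterp (f : V → ℝ) (x : MGPoint G) : ℝ :=
  (1 - x.1.2.2) * f x.1.1 + x.1.2.2 * f x.1.2.1

def VLip (G : SimpleGraph V) (f : V → ℝ) : Prop := ∀ u v, G.Adj u v → |f u - f v| ≤ 1

lemma VLip.walk {f : V → ℝ} (hf : VLip G f) {u v : V} (w : G.Walk u v) :
    |f u - f v| ≤ w.length := by
  induction w with
  | nil => simp
  | cons h p ih =>
    have := hf _ _ h
    push_cast [Walk.length_cons]
    rw [abs_le] at *
    constructor <;> linarith

lemma VLip.dist (hG : G.Connected) {f : V → ℝ} (hf : VLip G f) (u v : V) :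
    |f u - f v| ≤ G.dist u v := by
  obtain ⟨p, hl⟩ := hG.exists_walk_length_eq_dist u v
  rw [← hl]; exact hf.walk p

lemma VLip.vdist (hG : G.Connected) {f : V → ℝ} (hf : VLip G f) (v : V) (x : MGPoint G) :
    |mgInterp f x - f v| ≤ mgVDist G v x := by
  have h1 := hf.dist hG v x.1.1
  have h2 := hf.dist hG v x.1.2.1
  have h3 := hf _ _ x.2.1
  have h4 := x.2.2.1
  have h5 := x.2.2.2
  unfold mgVDist mgInterp
  rw [abs_le] at h1 h2 h3
  rw [le_min_iff]
  constructor <;> rw [abs_le] <;> constructor <;> nlinarith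

lemma VLip.mg (hG : G.Connected) {f : V → ℝ} (hf : VLip G f) (x y : MGPoint G) :
    |mgInterp f x - mgInterp f y| ≤ mgDist G x y := by
  have h3 := hf _ _ x.2.1
  have h3' := hf _ _ y.2.1
  have h4 := x.2.2.1
  have h5 := x.2.2.2
  have h6 := y.2.2.1
  have h7 := y.2.2.2
  have a1 := hf.dist hG x.1.1 y.1.1
  have a2 := hf.dist hG x.1.1 y.1.2.1
  have a3 := hf.dist hG x.1.2.1 y.1.1
  have a4 := hf.dist hG x.1.2.1 y.1.2.1
  unfold mgInterp
  rcases mgDist_cases hG x y with ⟨h1, h2, h⟩ | ⟨h1, h2, h⟩ | h | h | h | h <;> rw [h]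
  · rw [← h1, ← h2]
    have : (1 - x.1.2.2) * f x.1.1 + x.1.2.2 * f x.1.2.1 -
      ((1 - y.1.2.2) * f x.1.1 + y.1.2.2 * f x.1.2.1) =
      (x.1.2.2 - y.1.2.2) * (- (f x.1.1 - f x.1.2.1)) := by ring
    rw [this, abs_mul, abs_neg]
    exact mul_le_of_le_one_right (abs_nonneg _) h3
  · rw [← h1, ← h2]
    have : (1 - x.1.2.2) * f x.1.1 + x.1.2.2 * f x.1.2.1 -
      ((1 - y.1.2.2) * f x.1.2.1 + y.1.2.2 * f x.1.1) =
      (x.1.2.2 - (1 - y.1.2.2)) * (- (f x.1.1 - f x.1.2.1)) := by ring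
    rw [this, abs_mul, abs_neg]
    exact mul_le_of_le_one_right (abs_nonneg _) h3
  all_goals
    rw [abs_le] at *
    constructor <;> nlinarith

lemma mgDist_le_vdist (hG : G.Connected) (v : V) (x y : MGPoint G) :
    mgDist G x y ≤ mgVDist G v x + mgVDist G v y := by
  have tri : ∀ a b, (G.dist a b : ℝ) ≤ G.dist v a + G.dist v b := by
    intro a b
    have := hG.dist_triangle (u := a) (v := v) (w := b)
    rw [SimpleGraph.dist_comm] at this
    rw [SimpleGraph.dist_comm (u := v) (v := a)]
    rw [SimpleGraph.dist_comm] at this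
    exact_mod_cast this
  have t1 := tri x.1.1 y.1.1
  have t2 := tri x.1.1 y.1.2.1
  have t3 := tri x.1.2.1 y.1.1
  have t4 := tri x.1.2.1 y.1.2.1
  have l1 := mgDist_le1 x y
  have l2 := mgDist_le2 x y
  have l3 := mgDist_le3 x y
  have l4 := mgDist_le4 x y
  unfold mgVDist
  rcases min_choice ((G.dist v x.1.1 : ℝ) + x.1.2.2) ((G.dist v x.1.2.1 : ℝ) + (1 - x.1.2.2)) with h | h <;>
  rcases min_choice ((G.dist v y.1.1 : ℝ) + y.1.2.2) ((G.dist v y.1.2.1 : ℝ) + (1 - y.1.2.2)) with h' | h' <;>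
  rw [h, h'] <;> linarith

lemma mgVDist_le_add (hG : G.Connected) (v w : V) (x : MGPoint G) :
    mgVDist G v x ≤ G.dist v w + mgVDist G w x := by
  have t1 : (G.dist v x.1.1 : ℝ) ≤ G.dist v w + G.dist w x.1.1 := by
    exact_mod_cast hG.dist_triangle
  have t2 : (G.dist v x.1.2.1 : ℝ) ≤ G.dist v w + G.dist w x.1.2.1 := by
    exact_mod_cast hG.dist_triangle
  unfold mgVDist
  rcases min_choice ((G.dist w x.1.1 : ℝ) + x.1.2.2) ((G.dist w x.1.2.1 : ℝ) + (1 - x.1.2.2)) with h | h <;> rw [h]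
  · exact (min_le_left _ _).trans (by linarith)
  · exact (min_le_right _ _).trans (by linarith)

lemma mgDist_triangle (hG : G.Connected) (x y z : MGPoint G) :
    mgDist G x z ≤ mgDist G x y + mgDist G y z := by
  have tri : ∀ a b c, (G.dist a c : ℝ) ≤ G.dist a b + G.dist b c := by
    intro a b c; exact_mod_cast hG.dist_triangle
  have hd : (G.dist y.1.1 y.1.2.1 : ℝ) = 1 := by
    exact_mod_cast SimpleGraph.dist_eq_one_iff_adj.mpr y.2.1
  have hd' : (G.dist y.1.2.1 y.1.1 : ℝ) = 1 := by
    exact_mod_cast SimpleGraph.dist_eq_one_iff_adj.mpr y.2.1.symm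
  have h4 := x.2.2.1
  have h5 := x.2.2.2
  have h6 := y.2.2.1
  have h7 := y.2.2.2
  have h8 := z.2.2.1
  have h9 := z.2.2.2
  have l1 := mgDist_le1 x z
  have l2 := mgDist_le2 x z
  have l3 := mgDist_le3 x z
  have l4 := mgDist_le4 x z
  have l5 := mgDist_le5 x z
  have l6 := mgDist_le6 x z
  have A1 := tri x.1.1 y.1.1
  have A2 := tri x.1.1 y.1.2.1
  have A3 := tri x.1.2.1 y.1.1
  have A4 := tri x.1.2.1 y.1.2.1
  have B1 := tri y.1.1 y.1.2.1
  have B2 := tri y.1.2.1 y.1.1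
  rcases mgDist_cases hG x y with ⟨e1, e2, h⟩ | ⟨e1, e2, h⟩ | h | h | h | h <;>
  rcases mgDist_cases hG y z with ⟨e1', e2', h'⟩ | ⟨e1', e2', h'⟩ | h' | h' | h' | h' <;>
  rw [h, h']
  · refine (l5 (e1.trans e1') (e2.trans e2')).trans (abs_sub_le _ _ _)
  · refine (l6 (e1.trans e1') (e2.trans e2')).trans (abs_sub_le _ _ _)
  rotate_left 4
  · refine (l6 (e1.trans e2') (e2.trans e1')).trans ?_
    rcases abs_cases (x.1.2.2 - (1 - y.1.2.2)) with q | q <;>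
    rcases abs_cases (y.1.2.2 - z.1.2.2) with q' | q' <;>
    rcases abs_cases (x.1.2.2 - (1 - z.1.2.2)) with q'' | q'' <;> linarith
  · refine (l5 (e1.trans e2') (e2.trans e1')).trans ?_
    rcases abs_cases (x.1.2.2 - (1 - y.1.2.2)) with q | q <;>
    rcases abs_cases (y.1.2.2 - (1 - z.1.2.2)) with q' | q' <;>
    rcases abs_cases (x.1.2.2 - z.1.2.2) with q'' | q'' <;> linarith
  all_goals
    have A11 := A1 z.1.1
    have A12 := A1 z.1.2.1
    have A21 := A2 z.1.1
    have A22 := A2 z.1.2.1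
    have A31 := A3 z.1.1
    have A32 := A3 z.1.2.1
    have A41 := A4 z.1.1
    have A42 := A4 z.1.2.1
    have B11 := B1 z.1.1
    have B12 := B1 z.1.2.1
    have B21 := B2 z.1.1
    have B22 := B2 z.1.2.1
    clear A1 A2 A3 A4 B1 B2 tri l5 l6
    try rw [e1] at l1 l2
    try rw [e2] at l3 l4
    first | rw [← e1'] at l1 l3 | rw [← e1'] at l2 l4 | skip
    first | rw [← e2'] at l2 l4 | rw [← e2'] at l1 l3 | skip
    have q1 := le_abs_self (x.1.2.2 - y.1.2.2)
    have q2 := neg_abs_le (x.1.2.2 - y.1.2.2)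
    have q3 := le_abs_self (x.1.2.2 - (1 - y.1.2.2))
    have q4 := neg_abs_le (x.1.2.2 - (1 - y.1.2.2))
    have q5 := le_abs_self (y.1.2.2 - z.1.2.2)
    have q6 := neg_abs_le (y.1.2.2 - z.1.2.2)
    have q7 := le_abs_self (y.1.2.2 - (1 - z.1.2.2))
    have q8 := neg_abs_le (y.1.2.2 - (1 - z.1.2.2))
    clear h h' hG
    linarith

lemma mgInterp_continuousOn (hG : G.Connected) {f : V → ℝ} (hf : VLip G f) {a b : ℝ}
    {γ : ℝ → MGPoint G} (hγ : IsMGGeodesic G a b γ) :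
    ContinuousOn (fun s => mgInterp f (γ s)) (Icc a b) := by
  have : LipschitzOnWith 1 (fun s => mgInterp f (γ s)) (Icc a b) := by
    apply LipschitzOnWith.of_dist_le_mul
    intro x hx y hy
    rw [Real.dist_eq, Real.dist_eq, ← hγ.2 x hx y hy]
    simpa using hf.mg hG _ _
  exact this.continuousOn

/-- crossing a zero -/
lemma mg_ivt (hG : G.Connected) {f : V → ℝ} (hf : VLip G f) {a b : ℝ}
    {γ : ℝ → MGPoint G} (hγ : IsMGGeodesic G a b γ) {s t : ℝ} (hs : a ≤ s) (hst : s ≤ t) (ht : t ≤ b)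
    (h1 : mgInterp f (γ s) ≤ 0) (h2 : 0 ≤ mgInterp f (γ t)) :
    ∃ r ∈ Icc s t, mgInterp f (γ r) = 0 := by
  have hc := (mgInterp_continuousOn hG hf hγ).mono (Icc_subset_Icc hs ht)
  exact intermediate_value_Icc hst hc ⟨h1, h2⟩

lemma mg_ivt' (hG : G.Connected) {f : V → ℝ} (hf : VLip G f) {a b : ℝ}
    {γ : ℝ → MGPoint G} (hγ : IsMGGeodesic G a b γ) {s t : ℝ} (hs : a ≤ s) (hst : s ≤ t) (ht : t ≤ b)
    (h1 : 0 ≤ mgInterp f (γ s)) (h2 : mgInterp f (γ t) ≤ 0) :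
    ∃ r ∈ Icc s t, mgInterp f (γ r) = 0 := by
  have hc := (mgInterp_continuousOn hG hf hγ).mono (Icc_subset_Icc hs ht)
  exact intermediate_value_Icc' hst hc ⟨h2, h1⟩

end Generic

set_option linter.unusedSectionVars false

section Lower
variable {V : Type} [Fintype V] [DecidableEq V] {G : SimpleGraph V}

lemma girth_le_two_paths {u v : V} (p q : G.Walk u v) (hp : p.IsPath) (hq : q.IsPath)
    (hne : p ≠ q) : G.girth ≤ p.length + q.length := by
  classical
  set S : Set (Sym2 V) := {e | e ∈ p.edges ∨ e ∈ q.edges} with hS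
  have hSG : ∀ e ∈ S, e ∈ G.edgeSet := by
    rintro e (h | h)
    · exact p.edges_subset_edgeSet h
    · exact q.edges_subset_edgeSet h
  set H : SimpleGraph V := fromEdgeSet S with hH
  have hle : H ≤ G := by
    intro a b hab
    rw [hH, fromEdgeSet_adj] at hab
    exact hSG _ hab.1
  have hmem : ∀ e ∈ S, e ∈ H.edgeSet := by
    intro e he
    rw [hH, edgeSet_fromEdgeSet]
    exact ⟨he, fun h => G.not_isDiag_of_mem_edgeSet (hSG e he) h⟩
  have hp' : ∀ e ∈ p.edges, e ∈ H.edgeSet := fun e he => hmem e (Or.inl he)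
  have hq' : ∀ e ∈ q.edges, e ∈ H.edgeSet := fun e he => hmem e (Or.inr he)
  by_cases hac : H.IsAcyclic
  · exfalso
    have := (hac.subsingleton_path u v).elim ⟨p.transfer H hp', hp.transfer hp'⟩ ⟨q.transfer H hq', hq.transfer hq'⟩
    have h2 : p.transfer H hp' = q.transfer H hq' := congrArg Subtype.val this
    apply hne
    apply Walk.ext_support
    rw [← Walk.support_transfer p hp', ← Walk.support_transfer q hq', h2]
  · simp only [SimpleGraph.IsAcyclic, not_forall, not_not] at hac
    obtain ⟨a, w, hw⟩ := hac
    have h1 : G.girth ≤ w.length := by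
      have := (hw.mapLe hle).girth_le_length
      simpa using this
    refine h1.trans ?_
    have h2 : w.edges.Nodup := hw.isTrail.edges_nodup
    have h3 : w.edges ⊆ p.edges ++ q.edges := by
      intro e he
      have := w.edges_subset_edgeSet he
      rw [hH, edgeSet_fromEdgeSet] at this
      simpa [hS] using this.1
    have := (h2.subperm h3).length_le
    simpa using this

lemma cyc_arc {a : V} (w : G.Walk a a) (hw : w.IsCycle) (i j : ℕ) (hi : 1 ≤ i) (hij : i ≤ j)
    (hj : j ≤ w.length) : ∃ p : G.Walk (w.getVert i) (w.getVert j), p.IsPath ∧ p.length = j - i := by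
  have hl := Walk.length_tail_add_one hw.not_nil
  have : ∃ p : G.Walk (w.tail.getVert (i-1)) ((w.tail.drop (i-1)).getVert (j-i)),
      p.IsPath ∧ p.length = j - i := by
    refine ⟨(w.tail.drop (i-1)).take (j-i), (hw.isPath_tail.drop _).take _, ?_⟩
    rw [Walk.take_length, Walk.drop_length]
    omega
  rw [Walk.drop_getVert, Walk.getVert_tail, Walk.getVert_tail] at this
  rwa [show i - 1 + 1 = i by omega, show i - 1 + (j - i) + 1 = j by omega] at this

lemma cyc_arc' {a : V} (w : G.Walk a a) (i j : ℕ) (hij : i ≤ j)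
    (hj : j ≤ w.length) : G.dist (w.getVert i) (w.getVert j) ≤ j - i := by
  have : ∃ p : G.Walk (w.getVert i) ((w.drop i).getVert (j-i)), p.length = j - i := by
    refine ⟨(w.drop i).take (j-i), ?_⟩
    rw [Walk.take_length, Walk.drop_length]
    omega
  rw [Walk.drop_getVert] at this
  rw [show i + (j - i) = j by omega] at this
  obtain ⟨p, hp⟩ := this
  exact hp ▸ SimpleGraph.dist_le p

lemma cyc_dist1 (hG : G.Connected) {a : V} (w : G.Walk a a) (hw : w.IsCycle)
    (hg : w.length = G.girth) (i j : ℕ) (hi : 1 ≤ i) (hij : i ≤ j)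
    (hj : j ≤ w.length) :
    min (j - i) (w.length - (j - i)) ≤ G.dist (w.getVert i) (w.getVert j) := by
  obtain ⟨p, hp, hpl⟩ := cyc_arc w hw i j hi hij hj
  obtain ⟨q, hq, hql⟩ := hG.exists_path_of_dist (w.getVert i) (w.getVert j)
  by_cases h : p = q
  · subst h; omega
  · have := girth_le_two_paths p q hp hq h
    omega

lemma cyc_dist (hG : G.Connected) {a : V} (w : G.Walk a a) (hw : w.IsCycle)
    (hg : w.length = G.girth) (i j : ℕ) (hij : i ≤ j)
    (hj : j ≤ w.length) :
    G.dist (w.getVert i) (w.getVert j) = min (j - i) (w.length - (j - i)) := by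
  have h0 : w.getVert 0 = w.getVert w.length := by simp
  apply le_antisymm
  · apply le_min (cyc_arc' w i j hij hj)
    have h1 := cyc_arc' w 0 i (by omega) (by omega)
    have h2 := cyc_arc' w j w.length (by omega) (by omega)
    rw [← h0] at h2
    have := hG.dist_triangle (u := w.getVert j) (v := w.getVert 0) (w := w.getVert i)
    rw [SimpleGraph.dist_comm]
    omega
  · rcases Nat.eq_zero_or_pos i with rfl | hi
    · rcases Nat.eq_zero_or_pos j with rfl | hj'
      · simp
      have := cyc_dist1 hG w hw hg j w.length hj' hj le_rfl
      rw [← h0, SimpleGraph.dist_comm] at this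
      omega
    · exact cyc_dist1 hG w hw hg i j hi hij hj

end Lower

set_option linter.unusedSectionVars false

section Lower2
variable {V : Type} [Fintype V] [DecidableEq V] {G : SimpleGraph V}

noncomputable def cycPt (c : ℕ → V) (g : ℕ) (hg : 3 ≤ g)
    (hadj : ∀ k < g, G.Adj (c k) (c (k+1))) (θ : ℝ) : MGPoint G :=
  ⟨(c (min ⌊θ⌋₊ (g-1)), c (min ⌊θ⌋₊ (g-1) + 1), max 0 (min 1 (θ - (min ⌊θ⌋₊ (g-1) : ℕ)))),
    hadj _ (by omega), le_max_left _ _, max_le zero_le_one (min_le_left _ _)⟩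

lemma cycPt_dist_le (hG : G.Connected) (c : ℕ → V) (g : ℕ) (hg : 3 ≤ g)
    (hadj : ∀ k < g, G.Adj (c k) (c (k+1)))
    (hd : ∀ i j, i ≤ j → j ≤ g → G.dist (c i) (c j) = min (j-i) (g - (j-i)))
    (θ θ' : ℝ) (h0 : 0 ≤ θ) (h1 : θ ≤ θ') (h2 : θ' ≤ g) :
    mgDist G (cycPt c g hg hadj θ) (cycPt c g hg hadj θ') = min (θ' - θ) (g - (θ' - θ)) := by
  have key : ∀ θ : ℝ, 0 ≤ θ → θ ≤ g → ∃ k : ℕ, k < g ∧ k = min ⌊θ⌋₊ (g-1) ∧ (k:ℝ) ≤ θ ∧ θ ≤ k + 1 ∧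
      max 0 (min 1 (θ - (min ⌊θ⌋₊ (g-1) : ℕ))) = θ - k := by
    intro θ h0 h2
    have a1 : ((min ⌊θ⌋₊ (g-1) : ℕ) : ℝ) ≤ θ := by
      have : ((min ⌊θ⌋₊ (g-1) : ℕ) : ℝ) ≤ (⌊θ⌋₊ : ℝ) := by exact_mod_cast min_le_left _ _
      exact this.trans (Nat.floor_le h0)
    have a2 : θ ≤ ((min ⌊θ⌋₊ (g-1) : ℕ) : ℝ) + 1 := by
      rcases le_total ⌊θ⌋₊ (g-1) with h | h
      · rw [min_eq_left h]; exact (Nat.lt_floor_add_one θ).le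
      · rw [min_eq_right h]
        have : ((g-1 : ℕ) : ℝ) + 1 = g := by
          rw [Nat.cast_sub (by omega)]; simp
        linarith
    refine ⟨min ⌊θ⌋₊ (g-1), by omega, rfl, a1, a2, ?_⟩
    rw [min_eq_right (by linarith), max_eq_right (by linarith)]
  have hdr : ∀ i j, i ≤ j → j ≤ g → (G.dist (c i) (c j) : ℝ) = min ((j:ℝ)-i) (g - ((j:ℝ)-i)) := by
    intro i j hij hjg
    rw [hd i j hij hjg, Nat.cast_min, Nat.cast_sub (by omega : j - i ≤ g), Nat.cast_sub hij]
  have hneq : ∀ i j, i < j → j ≤ g → c i = c j → i = 0 ∧ j = g := by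
    intro i j hij hjg h
    have := hd i j hij.le hjg
    rw [h, SimpleGraph.dist_self] at this
    omega
  have hmono : min ⌊θ⌋₊ (g-1) ≤ min ⌊θ'⌋₊ (g-1) := by
    have := Nat.floor_mono h1
    omega
  obtain ⟨k, kg, ke, k1, k2, kt⟩ := key θ h0 (h1.trans h2)
  obtain ⟨l, lg, le, l1, l2, lt⟩ := key θ' (h0.trans h1) h2
  rw [← ke, ← le] at hmono
  have L1 := mgDist_le1 (cycPt c g hg hadj θ) (cycPt c g hg hadj θ')
  have L2 := mgDist_le2 (cycPt c g hg hadj θ) (cycPt c g hg hadj θ')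
  have L3 := mgDist_le3 (cycPt c g hg hadj θ) (cycPt c g hg hadj θ')
  have L4 := mgDist_le4 (cycPt c g hg hadj θ) (cycPt c g hg hadj θ')
  have L5 := mgDist_le5 (cycPt c g hg hadj θ) (cycPt c g hg hadj θ')
  have C := mgDist_cases hG (cycPt c g hg hadj θ) (cycPt c g hg hadj θ')
  set D := mgDist G (cycPt c g hg hadj θ) (cycPt c g hg hadj θ')
  simp only [cycPt] at L1 L2 L3 L4 L5 C
  rw [kt, lt, ← ke, ← le] at L1 L2 L3 L4 L5 C
  rcases hmono.eq_or_lt with rfl | hkl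
  · have b1 : G.dist (c k) (c (k+1)) = 1 := SimpleGraph.dist_eq_one_iff_adj.mpr (hadj k kg)
    have b2 : G.dist (c (k+1)) (c k) = 1 := SimpleGraph.dist_eq_one_iff_adj.mpr (hadj k kg).symm
    simp only [b1, b2, SimpleGraph.dist_self, Nat.cast_one, Nat.cast_zero] at L1 L2 L3 L4 L5 C
    have hg' : (3:ℝ) ≤ g := by exact_mod_cast hg
    rw [min_eq_left (by linarith)]
    have e1 : |θ - k - (θ' - k)| = θ' - θ := by
      rw [abs_sub_comm, abs_of_nonneg] <;> linarith
    apply le_antisymm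
    · exact (L5 trivial trivial).trans e1.le
    · rcases C with ⟨_, _, h⟩ | ⟨h, _, _⟩ | h | h | h | h
      · rw [h, e1]
      · exact absurd h (hadj k kg).ne
      all_goals linarith
  · have r1 := hdr k l hkl.le lg.le
    have r2 := hdr k (l+1) (by omega) lg
    have r3 := hdr (k+1) l hkl lg.le
    have r4 := hdr (k+1) (l+1) (by omega) lg
    have hklr : (k:ℝ) + 1 ≤ l := by exact_mod_cast hkl
    have lgr : (l:ℝ) + 1 ≤ g := by exact_mod_cast lg
    push_cast at r1 r2 r3 r4
    rw [r1] at L1 C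
    rw [r2] at L2 C
    rw [r3] at L3 C
    rw [r4] at L4 C
    apply le_antisymm
    · apply le_min
      · have := min_le_left ((l:ℝ) - (k+1)) (g - ((l:ℝ) - (k+1)))
        linarith
      · have := min_le_right ((l:ℝ) + 1 - k) (g - ((l:ℝ) +1 - k))
        linarith
    · rcases C with ⟨h, _, _⟩ | ⟨h, h', _⟩ | h | h | h | h
      · have := hneq k l hkl lg.le h
        omega
      · have a1 := hneq k (l+1) (by omega) lg h
        rcases (show k + 1 ≤ l from hkl).eq_or_lt with h3 | h3
        · omega
        · have := hneq (k+1) l h3 lg.le h'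
          omega
      · rw [h, min_le_iff]
        rcases min_choice ((l:ℝ) - k) (g - ((l:ℝ) - k)) with q | q <;> rw [q] <;>
        first
          | (left; linarith)
          | (right; linarith)
      · rw [h, min_le_iff]
        rcases min_choice ((l:ℝ) + 1 - k) (g - ((l:ℝ) + 1 - k)) with q | q <;> rw [q] <;>
        first
          | (left; linarith)
          | (right; linarith)
      · rw [h, min_le_iff]
        rcases min_choice ((l:ℝ) - (k+1)) (g - ((l:ℝ) - (k+1))) with q | q <;> rw [q] <;>
        first
          | (left; linarith)
          | (right; linarith)
      · rw [h, min_le_iff]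
        rcases min_choice ((l:ℝ) + 1 - (k+1)) (g - ((l:ℝ) + 1 - (k+1))) with q | q <;> rw [q] <;>
        first
          | (left; linarith)
          | (right; linarith)

end Lower2

set_option linter.unusedSectionVars false

section Lower3
variable {V : Type} [Fintype V] [DecidableEq V] {G : SimpleGraph V}

lemma mgDist_le_card (hG : G.Connected) (x y : MGPoint G) :
    mgDist G x y ≤ Fintype.card V + 1 := by
  have h1 := mgDist_le1 x y
  have h2 := mg_dist_lt_card hG x.1.1 y.1.1
  have h3 := x.2.2.2
  have h4 := y.2.2.2
  linarith

lemma triangleDelta_bddBelow (T : MGTriangle G) : BddBelow {d : ℝ | 0 ≤ d ∧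
    (∀ s ∈ Set.Icc T.a1 T.b1,
      (∃ t ∈ Set.Icc T.a2 T.b2, mgDist G (T.g1 s) (T.g2 t) ≤ d) ∨
      (∃ t ∈ Set.Icc T.a3 T.b3, mgDist G (T.g1 s) (T.g3 t) ≤ d)) ∧
    (∀ s ∈ Set.Icc T.a2 T.b2,
      (∃ t ∈ Set.Icc T.a1 T.b1, mgDist G (T.g2 s) (T.g1 t) ≤ d) ∨
      (∃ t ∈ Set.Icc T.a3 T.b3, mgDist G (T.g2 s) (T.g3 t) ≤ d)) ∧
    (∀ s ∈ Set.Icc T.a3 T.b3,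
      (∃ t ∈ Set.Icc T.a1 T.b1, mgDist G (T.g3 s) (T.g1 t) ≤ d) ∨
      (∃ t ∈ Set.Icc T.a2 T.b2, mgDist G (T.g3 s) (T.g2 t) ≤ d))} :=
  ⟨0, fun _ hd => hd.1⟩

lemma triangleDelta_card (hG : G.Connected) (T : MGTriangle G) : (Fintype.card V + 1 : ℝ) ∈ {d : ℝ | 0 ≤ d ∧
    (∀ s ∈ Set.Icc T.a1 T.b1,
      (∃ t ∈ Set.Icc T.a2 T.b2, mgDist G (T.g1 s) (T.g2 t) ≤ d) ∨
      (∃ t ∈ Set.Icc T.a3 T.b3, mgDist G (T.g1 s) (T.g3 t) ≤ d)) ∧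
    (∀ s ∈ Set.Icc T.a2 T.b2,
      (∃ t ∈ Set.Icc T.a1 T.b1, mgDist G (T.g2 s) (T.g1 t) ≤ d) ∨
      (∃ t ∈ Set.Icc T.a3 T.b3, mgDist G (T.g2 s) (T.g3 t) ≤ d)) ∧
    (∀ s ∈ Set.Icc T.a3 T.b3,
      (∃ t ∈ Set.Icc T.a1 T.b1, mgDist G (T.g3 s) (T.g1 t) ≤ d) ∨
      (∃ t ∈ Set.Icc T.a2 T.b2, mgDist G (T.g3 s) (T.g2 t) ≤ d))} := by
  refine ⟨by positivity, fun s _ => Or.inl ⟨T.a2, ⟨le_rfl, T.h2.1⟩, mgDist_le_card hG _ _⟩,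
    fun s _ => Or.inl ⟨T.a1, ⟨le_rfl, T.h1.1⟩, mgDist_le_card hG _ _⟩,
    fun s _ => Or.inl ⟨T.a1, ⟨le_rfl, T.h1.1⟩, mgDist_le_card hG _ _⟩⟩

lemma hypDelta_ge (hG : G.Connected) (T : MGTriangle G) : triangleDelta T ≤ hypDelta G := by
  apply le_csSup
  · refine ⟨Fintype.card V + 1, ?_⟩
    rintro d ⟨T, rfl⟩
    exact csInf_le (triangleDelta_bddBelow T) (triangleDelta_card hG T)
  · exact ⟨T, rfl⟩

lemma lower_bound (hG : G.Connected) (hg : 3 ≤ G.girth) : (G.girth : ℝ) / 4 ≤ hypDelta G := by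
  have hac : ¬ G.IsAcyclic := by
    intro h
    rw [← SimpleGraph.girth_eq_zero] at h
    omega
  obtain ⟨a, w, hw, hlen⟩ := SimpleGraph.exists_girth_eq_length.mpr hac
  have hadj : ∀ k < G.girth, G.Adj (w.getVert k) (w.getVert (k+1)) := by
    intro k hk
    exact w.adj_getVert_succ (by omega)
  have hd : ∀ i j, i ≤ j → j ≤ G.girth → G.dist (w.getVert i) (w.getVert j)
      = min (j-i) (G.girth - (j-i)) := by
    intro i j hij hj
    rw [hlen]
    exact cyc_dist hG w hw hlen.symm i j hij (by omega)
  have D := cycPt_dist_le hG w.getVert G.girth hg hadj hd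
  set P := cycPt w.getVert G.girth hg hadj
  set g : ℝ := (G.girth : ℝ) with hgdef
  have hg3 : (3:ℝ) ≤ g := by rw [hgdef]; exact_mod_cast hg
  have D' : ∀ θ θ', 0 ≤ θ → θ ≤ g → 0 ≤ θ' → θ' ≤ g →
      mgDist G (P θ) (P θ') = min |θ - θ'| (g - |θ - θ'|) := by
    intro θ θ' h1 h2 h3 h4
    rcases le_total θ θ' with h | h
    · rw [D θ θ' h1 h h4, abs_sub_comm, abs_of_nonneg (by linarith)]
    · rw [mgDist_comm hG, D θ' θ h3 h h2, abs_of_nonneg (by linarith)]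
  have geo : ∀ a b : ℝ, 0 ≤ a → a ≤ b → b ≤ g → b - a ≤ g / 2 → IsMGGeodesic G a b P := by
    intro a b h1 h2 h3 h4
    refine ⟨h2, fun s hs t ht => ?_⟩
    rw [D' s t (h1.trans hs.1) (hs.2.trans h3) (h1.trans ht.1) (ht.2.trans h3)]
    apply min_eq_left
    have : |s - t| ≤ g / 2 := by
      rw [abs_le]; constructor <;> linarith [hs.1, hs.2, ht.1, ht.2]
    linarith
  let T : MGTriangle G :=
    { a1 := 0, b1 := g/2, a2 := g/2, b2 := 3*g/4, a3 := 3*g/4, b3 := g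
      g1 := P, g2 := P, g3 := P
      h1 := geo _ _ le_rfl (by linarith) (by linarith) (by linarith)
      h2 := geo _ _ (by linarith) (by linarith) (by linarith) (by linarith)
      h3 := geo _ _ (by linarith) (by linarith) (by linarith) (by linarith)
      glue1 := by rw [D _ _ (by linarith) le_rfl (by linarith)]; rw [sub_self]; exact min_eq_left (by linarith)
      glue2 := by rw [D _ _ (by linarith) le_rfl (by linarith)]; rw [sub_self]; exact min_eq_left (by linarith)
      glue3 := by
        rw [mgDist_comm hG, D _ _ (by linarith) (by linarith) le_rfl]
        rw [sub_zero, sub_self]; exact min_eq_right (by linarith) }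
  refine le_trans ?_ (hypDelta_ge hG T)
  apply le_csInf ⟨_, triangleDelta_card hG T⟩
  rintro d ⟨-, h1, -, -⟩
  have hh : ∀ t, g/2 ≤ t → t ≤ g → g/4 ≤ mgDist G (P (g/4)) (P t) := by
    intro t ht1 ht2
    rw [D (g/4) t (by linarith) (by linarith) ht2]
    apply le_min <;> linarith
  rcases h1 (g/4) ⟨by change (0:ℝ) ≤ _; linarith, by change _ ≤ g / 2; linarith⟩ with ⟨t, ht, h⟩ | ⟨t, ht, h⟩
  · exact (hh t ht.1 (ht.2.trans (by change 3*g/4 ≤ g; linarith))).trans h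
  · exact (hh t (le_trans (by change g/2 ≤ 3*g/4; linarith) ht.1) ht.2).trans h

lemma Agcn_lower (g c n : ℕ) (hg : 5 ≤ g)
    (hadm : ∃ G : SimpleGraph (Fin n), memGclass g c G) : (g : ℝ) / 4 ≤ Agcn g c n := by
  obtain ⟨G, hG⟩ := hadm
  refine le_csInf (s := {d : ℝ | ∃ G : SimpleGraph (Fin n), memGclass g c G ∧ d = hypDelta G}) ⟨_, G, hG, rfl⟩ ?_
  rintro d ⟨G, ⟨h1, h2, h3⟩, rfl⟩
  rw [← h2]
  exact lower_bound h1 (by omega)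

lemma Agcn_upper (g c n : ℕ) (hg : 5 ≤ g) (G : SimpleGraph (Fin n)) (hG : memGclass g c G) (D : ℝ)
    (hD : hypDelta G ≤ D) : Agcn g c n ≤ D := by
  refine le_trans (csInf_le ⟨(g:ℝ)/4, ?_⟩ ⟨G, hG, rfl⟩) hD
  rintro d ⟨G, ⟨h1, h2, h3⟩, rfl⟩
  rw [← h2]
  exact lower_bound h1 (by omega)

end Lower3

set_option linter.unusedSectionVars false

section Thin
variable {V : Type} [Fintype V] [DecidableEq V] {G : SimpleGraph V}

/-- The abstract side condition: every geodesic is `D`-close to every crossing set `Q`. -/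
def SideThin (G : SimpleGraph V) (D : ℝ) : Prop :=
  ∀ (a b : ℝ) (γ : ℝ → MGPoint G) (Q : Set (MGPoint G)), IsMGGeodesic G a b γ →
    (∃ q ∈ Q, mgDist G (γ a) q ≤ 0) → (∃ q ∈ Q, mgDist G (γ b) q ≤ 0) →
    (∀ f, VLip G f → mgInterp f (γ a) ≤ 0 → 0 ≤ mgInterp f (γ b) → ∃ q ∈ Q, mgInterp f q = 0) →
    (∀ f, VLip G f → 0 ≤ mgInterp f (γ a) → mgInterp f (γ b) ≤ 0 → ∃ q ∈ Q, mgInterp f q = 0) →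
    ∀ s ∈ Icc a b, ∃ q ∈ Q, mgDist G (γ s) q ≤ D

lemma mgInterp_eq_of_dist (hG : G.Connected) {f : V → ℝ} (hf : VLip G f) {x y : MGPoint G}
    (h : mgDist G x y = 0) : mgInterp f x = mgInterp f y := by
  have := hf.mg hG x y
  rw [h] at this
  have := abs_nonpos_iff.mp this
  linarith

lemma side_of_thin (hG : G.Connected) {D : ℝ} (hD : SideThin G D)
    {a1 b1 a2 b2 a3 b3 : ℝ} {g1 g2 g3 : ℝ → MGPoint G}
    (h1 : IsMGGeodesic G a1 b1 g1) (h2 : IsMGGeodesic G a2 b2 g2) (h3 : IsMGGeodesic G a3 b3 g3)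
    (glue1 : mgDist G (g1 b1) (g2 a2) = 0) (glue2 : mgDist G (g2 b2) (g3 a3) = 0)
    (glue3 : mgDist G (g3 b3) (g1 a1) = 0) :
    ∀ s ∈ Set.Icc a1 b1,
      (∃ t ∈ Set.Icc a2 b2, mgDist G (g1 s) (g2 t) ≤ D) ∨
      (∃ t ∈ Set.Icc a3 b3, mgDist G (g1 s) (g3 t) ≤ D) := by
  intro s hs
  have key := hD a1 b1 g1 (g2 '' Icc a2 b2 ∪ g3 '' Icc a3 b3) h1
    ⟨g3 b3, Or.inr ⟨b3, ⟨h3.1, le_rfl⟩, rfl⟩, by rw [mgDist_comm hG, glue3]⟩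
    ⟨g2 a2, Or.inl ⟨a2, ⟨le_rfl, h2.1⟩, rfl⟩, by rw [glue1]⟩
    (by
      intro f hf q1 q2
      have e1 := mgInterp_eq_of_dist hG hf glue1
      have e2 := mgInterp_eq_of_dist hG hf glue2
      have e3 := mgInterp_eq_of_dist hG hf glue3
      rcases le_total 0 (mgInterp f (g2 b2)) with h | h
      · obtain ⟨r, hr, h0⟩ := mg_ivt' hG hf h3 le_rfl h3.1 le_rfl (by linarith) (by linarith)
        exact ⟨g3 r, Or.inr ⟨r, hr, rfl⟩, h0⟩
      · obtain ⟨r, hr, h0⟩ := mg_ivt' hG hf h2 le_rfl h2.1 le_rfl (by linarith) (by linarith)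
        exact ⟨g2 r, Or.inl ⟨r, hr, rfl⟩, h0⟩)
    (by
      intro f hf q1 q2
      have e1 := mgInterp_eq_of_dist hG hf glue1
      have e2 := mgInterp_eq_of_dist hG hf glue2
      have e3 := mgInterp_eq_of_dist hG hf glue3
      rcases le_total 0 (mgInterp f (g2 b2)) with h | h
      · obtain ⟨r, hr, h0⟩ := mg_ivt hG hf h2 le_rfl h2.1 le_rfl (by linarith) (by linarith)
        exact ⟨g2 r, Or.inl ⟨r, hr, rfl⟩, h0⟩
      · obtain ⟨r, hr, h0⟩ := mg_ivt hG hf h3 le_rfl h3.1 le_rfl (by linarith) (by linarith)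
        exact ⟨g3 r, Or.inr ⟨r, hr, rfl⟩, h0⟩) s hs
  obtain ⟨q, ⟨t, ht, rfl⟩ | ⟨t, ht, rfl⟩, hq⟩ := key
  · exact Or.inl ⟨t, ht, hq⟩
  · exact Or.inr ⟨t, ht, hq⟩

lemma hypDelta_le_of_thin (hG : G.Connected) {D : ℝ} (h0 : 0 ≤ D) (hD : SideThin G D) :
    hypDelta G ≤ D := by
  apply Real.sSup_le _ h0
  rintro d ⟨T, rfl⟩
  apply csInf_le (triangleDelta_bddBelow T)
  refine ⟨h0, side_of_thin hG hD T.h1 T.h2 T.h3 T.glue1 T.glue2 T.glue3, ?_,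
    side_of_thin hG hD T.h3 T.h1 T.h2 T.glue3 T.glue1 T.glue2⟩
  intro s hs
  exact (side_of_thin hG hD T.h2 T.h3 T.h1 T.glue2 T.glue3 T.glue1 s hs).symm

lemma IsMGGeodesic.reverse {a b : ℝ} {γ : ℝ → MGPoint G} (h : IsMGGeodesic G a b γ) :
    IsMGGeodesic G (-b) (-a) (fun t => γ (-t)) := by
  refine ⟨by linarith [h.1], fun s hs t ht => ?_⟩
  rw [h.2 (-s) ⟨by linarith [hs.2], by linarith [hs.1]⟩ (-t) ⟨by linarith [ht.2], by linarith [ht.1]⟩]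
  rw [show -s - -t = -(s-t) by ring, abs_neg]

end Thin

set_option linter.unusedSectionVars false

section FanDefs

/-- oriented adjacency relation of the fan: hub `0`, path `1, …, c-1`, spokes `v j`, leaves `≥ c` -/
def fanR (c m : ℕ) (v : ℕ → ℕ) (a b : ℕ) : Prop :=
  a < b ∧ ((a = 0 ∧ (c ≤ b ∨ ∃ j ≤ m, b = v j)) ∨ (1 ≤ a ∧ b = a + 1 ∧ b < c))

/-- the fan graph -/
def fanG (n c m : ℕ) (v : ℕ → ℕ) : SimpleGraph (Fin n) where
  Adj a b := fanR c m v a b ∨ fanR c m v b a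
  symm := ⟨fun _ _ h => h.symm⟩
  loopless := ⟨fun a h => by rcases h with h | h <;> exact absurd h.1 (lt_irrefl _)⟩

structure FanHyp (n c g L m : ℕ) (v : ℕ → ℕ) : Prop where
  hg : 5 ≤ g
  hcn : c ≤ n
  hm : 1 ≤ m
  v0 : v 0 = 1
  v1 : v 1 + 1 = g
  vm : v m + 1 = c
  lo : ∀ j < m, v j + g ≤ v (j+1) + 2
  hi : ∀ j < m, v (j+1) + 2 ≤ v j + L

variable {n c g L m : ℕ} {v : ℕ → ℕ}

lemma FanHyp.mono (h : FanHyp n c g L m v) {i j : ℕ} (hij : i < j) (hj : j ≤ m) :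
    v i + g ≤ v j + 2 := by
  induction j with
  | zero => omega
  | succ k ih =>
    have h1 := h.lo k (by omega)
    have := h.hg
    rcases Nat.lt_succ_iff_lt_or_eq.mp hij with h2 | h2
    · have := ih h2 (by omega)
      omega
    · subst h2; exact h1

lemma FanHyp.pos (h : FanHyp n c g L m v) {j : ℕ} (hj : j ≤ m) : 1 ≤ v j := by
  rcases Nat.eq_zero_or_pos j with rfl | h0
  · exact h.v0.ge
  · have := h.mono h0 hj
    have := h.hg
    have := h.v0
    omega

lemma FanHyp.lt (h : FanHyp n c g L m v) {j : ℕ} (hj : j ≤ m) : v j < c := by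
  have := h.vm
  have := h.hg
  rcases hj.eq_or_lt with rfl | h0
  · omega
  · have := h.mono h0 le_rfl
    omega

lemma FanHyp.c_ge (h : FanHyp n c g L m v) : g ≤ c := by
  have := h.lt h.hm
  have := h.v1
  omega

lemma FanHyp.npos (h : FanHyp n c g L m v) : 0 < n := by
  have := h.c_ge
  have := h.hg
  have := h.hcn
  omega

/-- vertex of the fan with given index -/
def FanHyp.x (h : FanHyp n c g L m v) (i : ℕ) : Fin n := ⟨i % n, Nat.mod_lt _ h.npos⟩

lemma FanHyp.x_val (h : FanHyp n c g L m v) {i : ℕ} (hi : i < n) : (h.x i).val = i :=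
  Nat.mod_eq_of_lt hi

lemma FanHyp.x_val' (h : FanHyp n c g L m v) {i : ℕ} (hi : i < c) : (h.x i).val = i :=
  Nat.mod_eq_of_lt (hi.trans_le h.hcn)

lemma FanHyp.x_self (h : FanHyp n c g L m v) (a : Fin n) : h.x a.val = a :=
  Fin.ext (Nat.mod_eq_of_lt a.2)

lemma FanHyp.x_0 (h : FanHyp n c g L m v) : (h.x 0).val = 0 := by
  simp [FanHyp.x]

lemma FanHyp.adj_hub (h : FanHyp n c g L m v) {j : ℕ} (hj : j ≤ m) :
    (fanG n c m v).Adj (h.x 0) (h.x (v j)) := by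
  left
  refine ⟨?_, Or.inl ⟨h.x_0, Or.inr ⟨j, hj, h.x_val' (h.lt hj)⟩⟩⟩
  rw [h.x_0, h.x_val' (h.lt hj)]
  exact h.pos hj

lemma FanHyp.adj_succ (h : FanHyp n c g L m v) {i : ℕ} (h1 : 1 ≤ i) (hi : i + 1 < c) :
    (fanG n c m v).Adj (h.x i) (h.x (i + 1)) := by
  left
  have e1 := h.x_val' (by omega : i < c)
  have e2 := h.x_val' hi
  refine ⟨?_, Or.inr ⟨?_, ?_, ?_⟩⟩ <;> omega

lemma FanHyp.adj_leaf (h : FanHyp n c g L m v) {a : Fin n} (ha : c ≤ a.val) :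
    (fanG n c m v).Adj (h.x 0) a := by
  left
  refine ⟨?_, Or.inl ⟨h.x_0, Or.inl ha⟩⟩
  rw [h.x_0]
  have := h.c_ge
  have := h.hg
  omega

lemma FanHyp.conn (h : FanHyp n c g L m v) : (fanG n c m v).Connected := by
  rw [SimpleGraph.connected_iff_exists_forall_reachable]
  refine ⟨h.x 0, ?_⟩
  have key : ∀ i, i < n → (fanG n c m v).Reachable (h.x 0) (h.x i) := by
    intro i
    induction i with
    | zero => intro _; exact SimpleGraph.Reachable.refl _
    | succ k ih =>
      intro hk
      rcases le_or_gt c (k+1) with h1 | h1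
      · exact (h.adj_leaf (by rw [h.x_val hk]; exact h1)).reachable
      · rcases Nat.eq_zero_or_pos k with rfl | h2
        · have := h.adj_hub (Nat.zero_le m)
          rw [h.v0] at this
          exact this.reachable
        · exact (ih (by omega)).trans (h.adj_succ h2 h1).reachable
  intro w
  have := key w.val w.2
  rwa [h.x_self] at this

lemma FanHyp.path_ex (h : FanHyp n c g L m v) (k : ℕ) (hk : 1 ≤ k) (hkc : k < c) :
    ∃ p : (fanG n c m v).Walk (h.x k) (h.x 1), p.IsPath ∧ p.length + 1 = k ∧
      ∀ a ∈ p.support, 1 ≤ a.val ∧ a.val ≤ k := by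
  induction k, hk using Nat.le_induction with
  | base =>
    refine ⟨Walk.nil, Walk.IsPath.nil, rfl, ?_⟩
    intro a ha
    simp only [Walk.support_nil, List.mem_singleton] at ha
    rw [ha, h.x_val' hkc]
    simp
  | succ k hk ih =>
    obtain ⟨p, hp, hl, hs⟩ := ih (by omega)
    refine ⟨Walk.cons (h.adj_succ hk hkc).symm p, ?_, by simp [hl], ?_⟩
    · rw [Walk.cons_isPath_iff]
      refine ⟨hp, fun hc => ?_⟩
      have := hs _ hc
      rw [h.x_val' hkc] at this
      omega
    · intro a ha
      rw [Walk.support_cons, List.mem_cons] at ha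
      rcases ha with rfl | ha
      · rw [h.x_val' hkc]; omega
      · have := hs a ha; omega

lemma FanHyp.cycle_ex (h : FanHyp n c g L m v) (j : ℕ) (hj : 1 ≤ j) (hjm : j ≤ m) :
    ∃ w : (fanG n c m v).Walk (h.x 0) (h.x 0), w.IsCycle ∧ w.length = v j + 1 := by
  obtain ⟨p, hp, hl, hs⟩ := h.path_ex (v j) (h.pos hjm) (h.lt hjm)
  have a1 := h.adj_hub hjm
  have a0 := h.adj_hub (Nat.zero_le m)
  rw [h.v0] at a0
  have hv := h.mono (i := 0) (by omega) hjm
  have := h.hg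
  have := h.v0
  have hns : h.x 0 ∉ p.support := by
    intro hc
    have := (hs _ hc).1
    rw [h.x_0] at this
    omega
  refine ⟨Walk.cons a1 (p.concat a0.symm), ?_, ?_⟩
  · rw [Walk.cons_isCycle_iff]
    refine ⟨hp.concat hns a0.symm, ?_⟩
    rw [Walk.edges_concat, List.concat_eq_append, List.mem_append]
    rintro (hc | hc)
    · exact hns (Walk.fst_mem_support_of_mem_edges p hc)
    · rw [List.mem_singleton, Sym2.eq_iff] at hc
      rcases hc with ⟨e1, e2⟩ | ⟨e1, e2⟩
      · exact a0.ne e1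
      · have := congrArg Fin.val e2
        rw [h.x_val' (h.lt hjm), h.x_val' (by have := h.lt hjm; omega)] at this
        omega
  · simp; omega

lemma fan_adj_nz (a b : Fin n) (hab : (fanG n c m v).Adj a b) (ha : a.val ≠ 0) (hb : b.val ≠ 0) :
    1 ≤ a.val ∧ a.val < c ∧ 1 ≤ b.val ∧ b.val < c ∧ (a.val = b.val + 1 ∨ b.val = a.val + 1) := by
  rcases hab with ⟨h1, ⟨h2, h3⟩ | ⟨h2, h3, h4⟩⟩ | ⟨h1, ⟨h2, h3⟩ | ⟨h2, h3, h4⟩⟩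
  · exact absurd h2 ha
  · omega
  · exact absurd h2 hb
  · omega

lemma fan_walk_nz {a b : Fin n} (w : (fanG n c m v).Walk a b) (hw : ∀ x ∈ w.support, x.val ≠ 0) :
    (a = b ∨ (1 ≤ a.val ∧ a.val < c ∧ 1 ≤ b.val ∧ b.val < c ∧ a.val ≤ b.val + w.length ∧
      b.val ≤ a.val + w.length)) ∧ (a.val < c → ∀ x ∈ w.support, 1 ≤ x.val ∧ x.val < c) := by
  induction w with
  | nil =>
    refine ⟨Or.inl rfl, fun ha x hx => ?_⟩
    have := hw x hx
    simp only [Walk.support_nil, List.mem_singleton] at hx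
    subst hx
    omega
  | @cons a b d hab p ih =>
    have hs : ∀ x ∈ p.support, x.val ≠ 0 := fun x hx => hw x (by simp [hx])
    obtain ⟨i1, i2⟩ := ih hs
    have ha := hw a (by simp)
    have hb := hs b (by simp)
    have := fan_adj_nz a b hab ha hb
    constructor
    · right
      rw [Walk.length_cons]
      rcases i1 with rfl | i1 <;> omega
    · intro hac x hx
      rw [Walk.support_cons, List.mem_cons] at hx
      rcases hx with rfl | hx
      · omega
      · exact i2 (by omega) x hx

lemma fan_adj_0 {a b : Fin n} (hab : (fanG n c m v).Adj a b) (ha : a.val = 0) :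
    c ≤ b.val ∨ ∃ j ≤ m, b.val = v j := by
  rcases hab with ⟨h1, ⟨h2, h3⟩ | ⟨h2, h3, h4⟩⟩ | ⟨h1, ⟨h2, h3⟩ | ⟨h2, h3, h4⟩⟩
  · exact h3
  · omega
  · omega
  · omega

lemma FanHyp.cycle_hub (h : FanHyp n c g L m v) {a : Fin n} (w : (fanG n c m v).Walk a a)
    (hw : w.IsCycle) : h.x 0 ∈ w.support := by
  classical
  by_contra hn
  have hz : ∀ x ∈ w.support, x.val ≠ 0 := by
    intro x hx h0
    apply hn
    have : h.x 0 = x := Fin.ext (by rw [h.x_0, h0])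
    rwa [this]
  obtain ⟨y, hy, hmax⟩ := Finset.exists_max_image w.support.toFinset (fun x => x.val)
    ⟨a, by simp⟩
  rw [List.mem_toFinset] at hy
  have hw' := hw.rotate hy
  have hsup : ∀ x ∈ (w.rotate y hy).support, x.val ≠ 0 ∧ x.val ≤ y.val := by
    intro x hx
    rw [Walk.mem_support_rotate_iff] at hx
    exact ⟨hz x hx, hmax x (by simpa using hx)⟩
  have hne := hw'.snd_ne_penultimate
  have k1 := (w.rotate y hy).adj_snd hw'.not_nil
  have k2 := (w.rotate y hy).adj_penultimate hw'.not_nil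
  have b1 : (w.rotate y hy).snd.val ≠ 0 ∧ (w.rotate y hy).snd.val ≤ y.val :=
    hsup _ ((w.rotate y hy).getVert_mem_support 1)
  have b2 : (w.rotate y hy).penultimate.val ≠ 0 ∧ (w.rotate y hy).penultimate.val ≤ y.val :=
    hsup _ ((w.rotate y hy).getVert_mem_support ((w.rotate y hy).length - 1))
  have b0 := hz y hy
  have c1 := fan_adj_nz _ _ k1 b0 b1.1
  have c2 := fan_adj_nz _ _ k2 b2.1 b0
  apply hne
  apply Fin.ext
  omega

lemma FanHyp.cycle_len0 (h : FanHyp n c g L m v) (w : (fanG n c m v).Walk (h.x 0) (h.x 0))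
    (hw : w.IsCycle) : g ≤ w.length ∧ w.length ≤ c := by
  classical
  cases w with
  | nil => exact absurd hw Walk.not_isCycle_nil
  | @cons _ u _ hu p =>
    rw [Walk.cons_isCycle_iff] at hw
    obtain ⟨hp, he⟩ := hw
    have hlen : p.length = p.reverse.length := by simp
    have hr : p.reverse.IsPath := hp.reverse
    have he' : s(h.x 0, u) ∉ p.reverse.edges := by simpa using he
    rw [Walk.length_cons, hlen]
    generalize p.reverse = r at *
    cases r with
    | nil => exact absurd hu (SimpleGraph.irrefl _)
    | @cons _ u' _ hu' q =>
      rw [Walk.cons_isPath_iff] at hr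
      obtain ⟨hq, hnot⟩ := hr
      have hne : u' ≠ u := by
        rintro rfl
        exact he' (by simp)
      have hz : ∀ x ∈ q.support, x.val ≠ 0 := by
        intro x hx h0
        apply hnot
        have : h.x 0 = x := Fin.ext (by rw [h.x_0, h0])
        rwa [this]
      obtain ⟨h1, h2⟩ := fan_walk_nz q hz
      rw [Walk.length_cons]
      rcases h1 with h1 | ⟨h3, h4, h5, h6, h7, h8⟩
      · exact absurd h1 hne
      constructor
      · rcases fan_adj_0 hu h.x_0 with q1 | ⟨j1, hj1, q1⟩
        · omega
        rcases fan_adj_0 hu' h.x_0 with q2 | ⟨j2, hj2, q2⟩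
        · omega
        rcases lt_trichotomy j1 j2 with hlt | heq | hlt
        · have := h.mono hlt hj2
          omega
        · exact absurd (Fin.ext (by rw [q1, q2, heq])) hne
        · have := h.mono hlt hj1
          omega
      · have h9 := h2 h4
        have hc : (q.support.toFinset.image (fun x => x.val)).card ≤ (Finset.Ico 1 c).card := by
          apply Finset.card_le_card
          intro i hi
          simp only [Finset.mem_image, List.mem_toFinset] at hi
          obtain ⟨x, hx, rfl⟩ := hi
          have := h9 x hx
          simpa using this
        rw [Finset.card_image_of_injective _ Fin.val_injective,
          List.toFinset_card_of_nodup hq.support_nodup, Walk.length_support, Nat.card_Ico] at hc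
        have := h.c_ge
        have := h.hg
        omega

lemma FanHyp.cycle_len (h : FanHyp n c g L m v) {a : Fin n} (w : (fanG n c m v).Walk a a)
    (hw : w.IsCycle) : g ≤ w.length ∧ w.length ≤ c := by
  classical
  have h0 := h.cycle_hub w hw
  have := h.cycle_len0 _ (hw.rotate h0)
  rwa [Walk.length_rotate] at this

lemma FanHyp.mem_class (h : FanHyp n c g L m v) : memGclass g c (fanG n c m v) := by
  refine ⟨h.conn, ?_, ?_⟩
  · obtain ⟨w, hw, hl⟩ := h.cycle_ex 1 le_rfl h.hm
    apply le_antisymm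
    · have := hw.girth_le_length
      have := h.v1
      omega
    · have hac : ¬ (fanG n c m v).IsAcyclic := fun hh => hh w hw
      obtain ⟨a, w', hw', hlen⟩ := SimpleGraph.exists_girth_eq_length.mpr hac
      rw [hlen]
      exact (h.cycle_len w' hw').1
  · apply IsGreatest.csSup_eq
    constructor
    · obtain ⟨w, hw, hl⟩ := h.cycle_ex m h.hm le_rfl
      exact ⟨_, w, hw, hl.trans h.vm⟩
    · rintro k ⟨a, w, hw, rfl⟩
      exact (h.cycle_len w hw).2

end FanDefs

set_option linter.unusedSectionVars false

section FanMetric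
variable {n c g L m : ℕ} {v : ℕ → ℕ}

/-- `x` is the point at distance `t` from `u` on the oriented edge `u → w` of the fan -/
def Canon (x : MGPoint (fanG n c m v)) (u w : Fin n) (t : ℝ) : Prop :=
  fanR c m v u w ∧ 0 ≤ t ∧ t ≤ 1 ∧ (x.1 = (u, w, t) ∨ x.1 = (w, u, 1 - t))

lemma canon_exists (x : MGPoint (fanG n c m v)) : ∃ u w t, Canon x u w t := by
  obtain ⟨⟨u, w, t⟩, hadj, h0, h1⟩ := x
  simp only at hadj h0 h1
  rcases hadj with h | h
  · exact ⟨u, w, t, h, h0, h1, Or.inl rfl⟩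
  · exact ⟨w, u, 1 - t, h, by linarith, by linarith, Or.inr (by simp)⟩

lemma Canon.D1 {x : MGPoint (fanG n c m v)} {u w : Fin n} {t : ℝ} (h : Canon x u w t) (z : Fin n) :
    mgVDist (fanG n c m v) z x ≤ (fanG n c m v).dist z u + t := by
  rcases h.2.2.2 with e | e
  · unfold mgVDist; rw [e]; exact min_le_left _ _
  · unfold mgVDist; rw [e]; exact (min_le_right _ _).trans (by simp)

lemma Canon.D2 {x : MGPoint (fanG n c m v)} {u w : Fin n} {t : ℝ} (h : Canon x u w t) (z : Fin n) :
    mgVDist (fanG n c m v) z x ≤ (fanG n c m v).dist z w + (1 - t) := by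
  rcases h.2.2.2 with e | e
  · unfold mgVDist; rw [e]; exact min_le_right _ _
  · unfold mgVDist; rw [e]; exact min_le_left _ _

lemma Canon.interp {x : MGPoint (fanG n c m v)} {u w : Fin n} {t : ℝ} (h : Canon x u w t)
    (f : Fin n → ℝ) : mgInterp f x = (1 - t) * f u + t * f w := by
  rcases h.2.2.2 with e | e
  · unfold mgInterp; rw [e]
  · unfold mgInterp; rw [e]; simp; ring

lemma Canon.same {x y : MGPoint (fanG n c m v)} {u w : Fin n} {t t' : ℝ} (h : Canon x u w t)
    (h' : Canon y u w t') : mgDist (fanG n c m v) x y ≤ |t - t'| := by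
  rcases h.2.2.2 with e | e <;> rcases h'.2.2.2 with e' | e'
  · exact (mgDist_le5 x y (by rw [e, e']) (by rw [e, e'])).trans (by rw [e, e'])
  · exact (mgDist_le6 x y (by rw [e, e']) (by rw [e, e'])).trans (by rw [e, e']; simp)
  · refine (mgDist_le6 x y (by rw [e, e']) (by rw [e, e'])).trans (le_of_eq ?_)
    rw [e, e']; simp only
    rw [abs_sub_comm]; congr 1; ring
  · refine (mgDist_le5 x y (by rw [e, e']) (by rw [e, e'])).trans (le_of_eq ?_)
    rw [e, e']; simp only
    rw [abs_sub_comm]; congr 1; ring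

lemma mgVDist_nonneg (z : Fin n) (x : MGPoint (fanG n c m v)) : 0 ≤ mgVDist (fanG n c m v) z x := by
  have h1 := x.2.2.1
  have h2 := x.2.2.2
  unfold mgVDist
  apply le_min
  · positivity
  · have : (0:ℝ) ≤ ((fanG n c m v).dist z x.1.2.1 : ℝ) := by positivity
    linarith

/-- the cut functions -/
noncomputable def cut (n c k : ℕ) (a : Fin n) : ℝ :=
  if a.val = 0 then 0 else if c ≤ a.val then -1 else max (-1) (min 1 ((a.val : ℝ) - k))

lemma cut_abs (k : ℕ) (a : Fin n) : |cut n c k a| ≤ 1 := by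
  unfold cut
  split_ifs
  · simp
  · simp
  · rw [abs_le]
    exact ⟨le_max_left _ _, max_le (by norm_num) (min_le_left _ _)⟩

lemma cut_0 (k : ℕ) (a : Fin n) (ha : a.val = 0) : cut n c k a = 0 := by
  unfold cut; rw [if_pos ha]

lemma cut_leaf (k : ℕ) (a : Fin n) (ha : c ≤ a.val) (h0 : a.val ≠ 0) : cut n c k a = -1 := by
  unfold cut; rw [if_neg h0, if_pos ha]

lemma cut_mid (k : ℕ) (a : Fin n) (ha : a.val < c) (h0 : a.val ≠ 0) :
    cut n c k a = max (-1) (min 1 ((a.val : ℝ) - k)) := by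
  unfold cut; rw [if_neg h0, if_neg (by omega)]

lemma cut_lt (k : ℕ) (a : Fin n) (ha : a.val < c) (h0 : a.val ≠ 0) (h : a.val < k) :
    cut n c k a = -1 := by
  rw [cut_mid k a ha h0]
  have : (a.val : ℝ) + 1 ≤ k := by exact_mod_cast h
  rw [min_eq_right (by linarith), max_eq_left (by linarith)]

lemma cut_gt (k : ℕ) (a : Fin n) (ha : a.val < c) (h0 : a.val ≠ 0) (h : k < a.val) :
    cut n c k a = 1 := by
  rw [cut_mid k a ha h0]
  have : (k : ℝ) + 1 ≤ a.val := by exact_mod_cast h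
  rw [min_eq_left (by linarith), max_eq_right (by linarith)]

lemma cut_eq (k : ℕ) (a : Fin n) (ha : a.val < c) (h0 : a.val ≠ 0) (h : a.val = k) :
    cut n c k a = 0 := by
  rw [cut_mid k a ha h0, h]
  simp

lemma cut_anti {k l : ℕ} (h : k ≤ l) (a : Fin n) : cut n c l a ≤ cut n c k a := by
  unfold cut
  split_ifs
  · exact le_rfl
  · exact le_rfl
  · have : (k:ℝ) ≤ l := by exact_mod_cast h
    exact max_le_max le_rfl (min_le_min le_rfl (by linarith))

lemma interp_anti {k l : ℕ} (h : k ≤ l) (x : MGPoint (fanG n c m v)) :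
    mgInterp (cut n c l) x ≤ mgInterp (cut n c k) x := by
  have h1 := x.2.2.1
  have h2 := x.2.2.2
  unfold mgInterp
  have e1 := cut_anti (c := c) h x.1.1
  have e2 := cut_anti (c := c) h x.1.2.1
  have := mul_le_mul_of_nonneg_left e1 (sub_nonneg.mpr h2)
  have := mul_le_mul_of_nonneg_left e2 h1
  linarith

lemma cut_lipR (k : ℕ) (a b : Fin n) (h : fanR c m v a b) : |cut n c k a - cut n c k b| ≤ 1 := by
  obtain ⟨h1, ⟨h2, h3⟩ | ⟨h2, h3, h4⟩⟩ := h
  · rw [cut_0 k a h2, zero_sub, abs_neg]; exact cut_abs k b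
  · rcases lt_trichotomy a.val k with h5 | h5 | h5
    · rw [cut_lt k a (by omega) (by omega) h5]
      rcases (show b.val ≤ k by omega).eq_or_lt with h6 | h6
      · rw [cut_eq k b h4 (by omega) h6]; norm_num
      · rw [cut_lt k b h4 (by omega) h6]; norm_num
    · rw [cut_eq k a (by omega) (by omega) h5, cut_gt k b h4 (by omega) (by omega)]; norm_num
    · rw [cut_gt k a (by omega) (by omega) h5, cut_gt k b h4 (by omega) (by omega)]; norm_num

lemma cut_lip (k : ℕ) : VLip (fanG n c m v) (cut n c k) := by
  intro a b hab
  rcases hab with h | h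
  · exact cut_lipR k a b h
  · rw [abs_sub_comm]; exact cut_lipR k b a h

/-- zero set of a cut function -/
lemma FanHyp.cut_zero (h : FanHyp n c g L m v) {k : ℕ} (hk1 : 1 ≤ k) (hkc : k < c)
    (x : MGPoint (fanG n c m v)) (h0 : mgInterp (cut n c k) x = 0) :
    mgVDist (fanG n c m v) (h.x 0) x ≤ 0 ∨ mgVDist (fanG n c m v) (h.x k) x ≤ 0 ∨
    ((∃ j ≤ m, k = v j) ∧ ∃ e : ℝ, 0 ≤ e ∧ e ≤ 1 ∧ mgVDist (fanG n c m v) (h.x 0) x ≤ e ∧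
      mgVDist (fanG n c m v) (h.x k) x ≤ 1 - e) := by
  obtain ⟨u, w, t, hc⟩ := canon_exists x
  have ht0 := hc.2.1
  have ht1 := hc.2.2.1
  rw [hc.interp] at h0
  have d1 := hc.D1
  have d2 := hc.D2
  obtain ⟨h1, ⟨h2, h3⟩ | ⟨h2, h3, h4⟩⟩ := hc.1
  · have eu : h.x 0 = u := Fin.ext (by rw [h.x_0, h2])
    have dH : mgVDist (fanG n c m v) (h.x 0) x ≤ t := by
      have := d1 (h.x 0)
      rw [eu, SimpleGraph.dist_self] at this
      rw [eu]; simpa using this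
    rw [cut_0 k u h2] at h0
    by_cases hl : c ≤ w.val
    · rw [cut_leaf k w hl (by omega)] at h0
      left; linarith
    · rcases h3 with h3 | ⟨j, hj, h3⟩
      · exact absurd h3 hl
      rcases lt_trichotomy w.val k with h5 | h5 | h5
      · rw [cut_lt k w (by omega) (by omega) h5] at h0
        left; linarith
      · right; right
        refine ⟨⟨j, hj, by omega⟩, t, ht0, ht1, dH, ?_⟩
        have ew : h.x k = w := Fin.ext (by rw [h.x_val' hkc, h5])
        have := d2 (h.x k)
        rw [ew, SimpleGraph.dist_self] at this
        rw [ew]; simpa using this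
      · rw [cut_gt k w (by omega) (by omega) h5] at h0
        left; linarith
  · right; left
    rcases lt_trichotomy u.val k with h5 | h5 | h5
    · rw [cut_lt k u (by omega) (by omega) h5] at h0
      rcases (show w.val ≤ k by omega).eq_or_lt with h6 | h6
      · rw [cut_eq k w h4 (by omega) h6] at h0
        have ew : h.x k = w := Fin.ext (by rw [h.x_val' hkc, h6])
        have := d2 (h.x k)
        rw [ew, SimpleGraph.dist_self] at this
        rw [ew]
        push_cast at this
        linarith
      · rw [cut_lt k w h4 (by omega) h6] at h0
        linarith
    · rw [cut_eq k u (by omega) (by omega) h5, cut_gt k w h4 (by omega) (by omega)] at h0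
      have ew : h.x k = u := Fin.ext (by rw [h.x_val' hkc, h5])
      have := d1 (h.x k)
      rw [ew, SimpleGraph.dist_self] at this
      rw [ew]
      push_cast at this
      linarith
    · rw [cut_gt k u (by omega) (by omega) h5, cut_gt k w h4 (by omega) (by omega)] at h0
      linarith

/-- points on the spoke to `k` -/
def FanHyp.Z (h : FanHyp n c g L m v) (k : ℕ) (x : MGPoint (fanG n c m v)) : Prop :=
  ∃ e : ℝ, 0 ≤ e ∧ e ≤ 1 ∧ mgVDist (fanG n c m v) (h.x 0) x ≤ e ∧
      mgVDist (fanG n c m v) (h.x k) x ≤ 1 - e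

lemma FanHyp.dist_hub (h : FanHyp n c g L m v) {j : ℕ} (hj : j ≤ m) :
    ((fanG n c m v).dist (h.x 0) (h.x (v j)) : ℝ) = 1 := by
  exact_mod_cast SimpleGraph.dist_eq_one_iff_adj.mpr (h.adj_hub hj)

lemma FanHyp.Z_of_hub (h : FanHyp n c g L m v) {j : ℕ} (hj : j ≤ m) (x : MGPoint (fanG n c m v))
    (h0 : mgVDist (fanG n c m v) (h.x 0) x ≤ 0) : h.Z (v j) x := by
  refine ⟨0, le_rfl, zero_le_one, h0, ?_⟩
  have := mgVDist_le_add h.conn (h.x (v j)) (h.x 0) x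
  rw [SimpleGraph.dist_comm, h.dist_hub hj] at this
  linarith

lemma FanHyp.Z_of_zero (h : FanHyp n c g L m v) {j : ℕ} (hj : j ≤ m) (x : MGPoint (fanG n c m v))
    (h0 : mgInterp (cut n c (v j)) x = 0) : h.Z (v j) x := by
  rcases h.cut_zero (h.pos hj) (h.lt hj) x h0 with h1 | h1 | ⟨_, h1⟩
  · exact h.Z_of_hub hj x h1
  · refine ⟨1, zero_le_one, le_rfl, ?_, by linarith⟩
    have := mgVDist_le_add h.conn (h.x 0) (h.x (v j)) x
    rw [h.dist_hub hj] at this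
    linarith
  · exact h1

lemma FanHyp.Z_close (h : FanHyp n c g L m v) {k : ℕ} {x y : MGPoint (fanG n c m v)}
    (hx : h.Z k x) (hy : h.Z k y) : mgDist (fanG n c m v) x y ≤ 1 := by
  obtain ⟨e, _, _, h1, h2⟩ := hx
  obtain ⟨e', _, _, h1', h2'⟩ := hy
  have a1 := mgDist_le_vdist h.conn (h.x 0) x y
  have a2 := mgDist_le_vdist h.conn (h.x k) x y
  linarith

lemma FanHyp.Z_dist (h : FanHyp n c g L m v) {k : ℕ} {x y : MGPoint (fanG n c m v)}
    (hy : h.Z k y) : mgDist (fanG n c m v) x y ≤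
      (mgVDist (fanG n c m v) (h.x 0) x + mgVDist (fanG n c m v) (h.x k) x + 1) / 2 := by
  obtain ⟨e', _, _, h1', h2'⟩ := hy
  have a1 := mgDist_le_vdist h.conn (h.x 0) x y
  have a2 := mgDist_le_vdist h.conn (h.x k) x y
  linarith

lemma FanHyp.Z_hub2 (h : FanHyp n c g L m v) {k l : ℕ} {x y : MGPoint (fanG n c m v)}
    (hx : h.Z k x) (hy : h.Z l y) : mgDist (fanG n c m v) x y ≤ 2 := by
  obtain ⟨e, _, _, h1, h2⟩ := hx
  obtain ⟨e', _, _, h1', h2'⟩ := hy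
  have a1 := mgDist_le_vdist h.conn (h.x 0) x y
  linarith

end FanMetric

set_option linter.unusedSectionVars false

section FanMain
variable {n c g L m : ℕ} {v : ℕ → ℕ}

/-- bump function used to separate a non-spoke vertex from the hub -/
noncomputable def bump (n k : ℕ) (a : Fin n) : ℝ :=
  if a.val = k then 1 else if a.val = 0 then -1 else 0

lemma bump_lip {k : ℕ} (hk0 : k ≠ 0) (hkc : k < c) (hk : ∀ j ≤ m, k ≠ v j) :
    VLip (fanG n c m v) (bump n k) := by
  have key : ∀ a b : Fin n, fanR c m v a b → |bump n k a - bump n k b| ≤ 1 := by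
    rintro a b ⟨h1, ⟨h2, h3⟩ | ⟨h2, h3, h4⟩⟩
    · have hb : b.val ≠ k := by
        rcases h3 with h3 | ⟨j, hj, h3⟩
        · omega
        · intro hh; exact hk j hj (by omega)
      unfold bump
      rw [if_neg (by omega), if_pos h2, if_neg hb, if_neg (by omega)]
      norm_num
    · unfold bump
      rw [if_neg (show ¬ a.val = 0 by omega), if_neg (show ¬ b.val = 0 by omega)]
      split_ifs <;> norm_num
  intro a b hab
  rcases hab with h | h
  · exact key a b h
  · rw [abs_sub_comm]; exact key b a h

lemma FanHyp.bump_Z (h : FanHyp n c g L m v) {k : ℕ} (hk0 : k ≠ 0) (hkc : k < c)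
    (hk : ∀ j ≤ m, k ≠ v j) {l : ℕ} {x y : MGPoint (fanG n c m v)} (hx : h.Z l x)
    (hy : mgVDist (fanG n c m v) (h.x k) y ≤ 0) : 1 ≤ mgDist (fanG n c m v) x y := by
  have hf := bump_lip (n := n) hk0 hkc hk
  obtain ⟨e, e0, e1, h1, h2⟩ := hx
  have a1 := hf.vdist h.conn (h.x 0) x
  have a2 := hf.vdist h.conn (h.x k) y
  have a3 := hf.mg h.conn x y
  have b1 : bump n k (h.x 0) = -1 := by
    unfold bump; rw [h.x_0, if_neg (by omega), if_pos rfl]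
  have b2 : bump n k (h.x k) = 1 := by
    unfold bump; rw [h.x_val' hkc, if_pos rfl]
  rw [b1] at a1
  rw [b2] at a2
  rw [abs_le] at a1 a2 a3
  linarith [a1.2, a2.1, a3.1]

lemma FanHyp.bump_succ (h : FanHyp n c g L m v) {k : ℕ} (hk0 : k ≠ 0) (hkc : k + 1 < c)
    (hk : ∀ j ≤ m, k ≠ v j) {x y : MGPoint (fanG n c m v)}
    (hx : mgVDist (fanG n c m v) (h.x k) x ≤ 0)
    (hy : mgVDist (fanG n c m v) (h.x (k+1)) y ≤ 0) : 1 ≤ mgDist (fanG n c m v) x y := by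
  have hf := bump_lip (n := n) hk0 (by omega : k < c) hk
  have a1 := hf.vdist h.conn (h.x k) x
  have a2 := hf.vdist h.conn (h.x (k+1)) y
  have a3 := hf.mg h.conn x y
  have b1 : bump n k (h.x k) = 1 := by
    unfold bump; rw [h.x_val' (by omega), if_pos rfl]
  have b2 : bump n k (h.x (k+1)) = 0 := by
    unfold bump; rw [h.x_val' hkc, if_neg (by omega), if_neg (by omega)]
  rw [b1] at a1
  rw [b2] at a2
  rw [abs_le] at a1 a2 a3
  linarith [a1.1, a2.2, a3.2]

/-- gate conditions -/
def FanHyp.gate (h : FanHyp n c g L m v) (j : ℕ) (x : MGPoint (fanG n c m v)) : Prop :=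
  mgVDist (fanG n c m v) (h.x 0) x + mgVDist (fanG n c m v) (h.x (v j)) x + 1 ≤ L

def FanHyp.Rt (h : FanHyp n c g L m v) (j : ℕ) (x : MGPoint (fanG n c m v)) : Prop :=
  mgInterp (cut n c (v j)) x ≤ 0 ∧ h.gate j x

def FanHyp.Lf (h : FanHyp n c g L m v) (j : ℕ) (x : MGPoint (fanG n c m v)) : Prop :=
  0 ≤ mgInterp (cut n c (v j)) x ∧ h.gate j x

lemma FanHyp.v_mono (h : FanHyp n c g L m v) {i j : ℕ} (hij : i ≤ j) (hj : j ≤ m) : v i ≤ v j := by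
  rcases hij.eq_or_lt with rfl | h1
  · exact le_rfl
  · have := h.mono h1 hj
    have := h.hg
    omega

/-- the two crossing times -/
lemma FanHyp.crossing (h : FanHyp n c g L m v) {a b : ℝ} {γ : ℝ → MGPoint (fanG n c m v)}
    (hγ : IsMGGeodesic (fanG n c m v) a b γ) {j1 j2 : ℕ} (hj : j1 ≤ j2) (hj2 : j2 ≤ m)
    (hx : mgInterp (cut n c (v j1)) (γ a) ≤ 0) (hy : 0 ≤ mgInterp (cut n c (v j2)) (γ b)) :
    ∃ τ0 ∈ Icc a b, ∃ τ3 ∈ Icc a b, τ3 ≤ τ0 ∧ h.Z (v j1) (γ τ0) ∧ h.Z (v j2) (γ τ3) := by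
  have hG := h.conn
  have hy1 : 0 ≤ mgInterp (cut n c (v j1)) (γ b) := hy.trans (interp_anti (h.v_mono hj hj2) _)
  have hx2 : mgInterp (cut n c (v j2)) (γ a) ≤ 0 := (interp_anti (h.v_mono hj hj2) _).trans hx
  obtain ⟨τ0, ht0, z0⟩ := mg_ivt hG (cut_lip (v j1)) hγ le_rfl hγ.1 le_rfl hx hy1
  have Z0 := h.Z_of_zero (hj.trans hj2) _ z0
  rcases hj.eq_or_lt with rfl | hlt
  · exact ⟨τ0, ht0, τ0, ht0, le_rfl, Z0, Z0⟩
  obtain ⟨τ3, ht3, z3⟩ := mg_ivt hG (cut_lip (v j2)) hγ le_rfl hγ.1 le_rfl hx2 hy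
  have Z3 := h.Z_of_zero hj2 _ z3
  rcases le_or_gt τ3 τ0 with hle | hgt
  · exact ⟨τ0, ht0, τ3, ht3, hle, Z0, Z3⟩
  have hp1 := h.pos (hj.trans hj2)
  have hgap := h.mono hlt hj2
  have hg5 := h.hg
  have hlt2 := h.lt hj2
  have hns : ∀ k, v j1 < k → k < v j1 + 3 → ∀ j ≤ m, k ≠ v j := by
    intro k hk1 hk2 j hjm he
    rcases le_or_gt j j1 with hh | hh
    · have := h.v_mono hh (hj.trans hj2)
      omega
    · have := h.mono hh hjm
      omega
  have hub : ∀ τ ∈ Icc a b, mgVDist (fanG n c m v) (h.x 0) (γ τ) ≤ 0 →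
      ∃ τ0 ∈ Icc a b, ∃ τ3 ∈ Icc a b, τ3 ≤ τ0 ∧ h.Z (v j1) (γ τ0) ∧ h.Z (v j2) (γ τ3) := by
    intro τ hτ h0
    exact ⟨τ, hτ, τ, hτ, le_rfl, h.Z_of_hub (hj.trans hj2) _ h0, h.Z_of_hub hj2 _ h0⟩
  obtain ⟨τ1, ht1, z1⟩ := mg_ivt hG (cut_lip (v j1 + 1)) hγ ht0.1 hgt.le ht3.2
    ((interp_anti (by omega) _).trans z0.le) (z3.ge.trans (interp_anti (by omega) _))
  have ht1' : τ1 ∈ Icc a b := ⟨ht0.1.trans ht1.1, ht1.2.trans ht3.2⟩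
  rcases h.cut_zero (by omega) (by omega) _ z1 with q | q1 | ⟨⟨j, hjm, q⟩, _⟩
  · exact hub τ1 ht1' q
  rotate_left
  · exact absurd q (hns _ (by omega) (by omega) j hjm)
  obtain ⟨τ2, ht2, z2⟩ := mg_ivt hG (cut_lip (v j1 + 1 + 1)) hγ ht1'.1 ht1.2 ht3.2
    ((interp_anti (by omega) _).trans z1.le) (z3.ge.trans (interp_anti (by omega) _))
  have ht2' : τ2 ∈ Icc a b := ⟨ht1'.1.trans ht2.1, ht2.2.trans ht3.2⟩
  rcases h.cut_zero (by omega) (by omega) _ z2 with q | q2 | ⟨⟨j, hjm, q⟩, _⟩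
  · exact hub τ2 ht2' q
  rotate_left
  · exact absurd q (hns _ (by omega) (by omega) j hjm)
  exfalso
  have A1 := h.bump_Z (by omega) (by omega) (hns (v j1 + 1) (by omega) (by omega)) Z0 q1
  have A2 := h.bump_succ (by omega) (by omega) (hns (v j1 + 1) (by omega) (by omega)) q1 q2
  have A3 := h.bump_Z (by omega) (by omega) (hns (v j1 + 1 + 1) (by omega) (by omega)) Z3 q2
  have A4 := h.Z_hub2 Z0 Z3
  rw [hγ.2 _ ht0 _ ht1', abs_sub_comm, abs_of_nonneg (by linarith [ht1.1])] at A1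
  rw [hγ.2 _ ht1' _ ht2', abs_sub_comm, abs_of_nonneg (by linarith [ht2.1])] at A2
  rw [hγ.2 _ ht3 _ ht2', abs_of_nonneg (by linarith [ht2.2])] at A3
  rw [hγ.2 _ ht0 _ ht3, abs_sub_comm, abs_of_nonneg (by linarith)] at A4
  linarith

/-- the main oriented estimate -/
lemma FanHyp.oriented (h : FanHyp n c g L m v) {a b : ℝ} {γ : ℝ → MGPoint (fanG n c m v)}
    (hγ : IsMGGeodesic (fanG n c m v) a b γ) {j1 j2 : ℕ} (hj : j1 ≤ j2) (hj2 : j2 ≤ m)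
    (hx : h.Rt j1 (γ a)) (hy : h.Lf j2 (γ b)) (Q : Set (MGPoint (fanG n c m v)))
    (hQa : ∃ q ∈ Q, mgDist (fanG n c m v) (γ a) q ≤ 0)
    (hQb : ∃ q ∈ Q, mgDist (fanG n c m v) (γ b) q ≤ 0)
    (hQ : ∀ f, VLip (fanG n c m v) f → mgInterp f (γ a) ≤ 0 → 0 ≤ mgInterp f (γ b) →
      ∃ q ∈ Q, mgInterp f q = 0) :
    ∀ s ∈ Icc a b, ∃ q ∈ Q, mgDist (fanG n c m v) (γ s) q ≤ ((L : ℝ) + 2) / 4 := by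
  have hG := h.conn
  have hy1 : 0 ≤ mgInterp (cut n c (v j1)) (γ b) := hy.1.trans (interp_anti (h.v_mono hj hj2) _)
  have hx2 : mgInterp (cut n c (v j2)) (γ a) ≤ 0 := (interp_anti (h.v_mono hj hj2) _).trans hx.1
  obtain ⟨τ0, ht0, τ3, ht3, hle, Z0, Z3⟩ := h.crossing hγ hj hj2 hx.1 hy.1
  have hab := hγ.1
  obtain ⟨qa, hqa, da⟩ := hQa
  obtain ⟨qb, hqb, db⟩ := hQb
  obtain ⟨q0, hq0, f0⟩ := hQ _ (cut_lip (v j1)) hx.1 hy1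
  obtain ⟨q3, hq3, f3⟩ := hQ _ (cut_lip (v j2)) hx2 hy.1
  have C0 := h.Z_close Z0 (h.Z_of_zero (hj.trans hj2) _ f0)
  have C3 := h.Z_close Z3 (h.Z_of_zero hj2 _ f3)
  have E0 := h.Z_dist (x := γ a) Z0
  have E3 := h.Z_dist (x := γ b) Z3
  have g0 := hx.2
  have g3 := hy.2
  unfold FanHyp.gate at g0 g3
  rw [hγ.2 a ⟨le_rfl, hab⟩ _ ht0, abs_sub_comm, abs_of_nonneg (by linarith [ht0.1])] at E0
  rw [hγ.2 b ⟨hab, le_rfl⟩ _ ht3, abs_of_nonneg (by linarith [ht3.2])] at E3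
  intro s hs
  rcases le_total s τ0 with h1 | h1
  · have T1 := mgDist_triangle hG (γ s) (γ a) qa
    have T2 := mgDist_triangle hG (γ s) (γ τ0) q0
    rw [hγ.2 s hs a ⟨le_rfl, hab⟩, abs_of_nonneg (by linarith [hs.1])] at T1
    rw [hγ.2 s hs _ ht0, abs_sub_comm, abs_of_nonneg (by linarith [hs.1])] at T2
    rcases le_total (s - a) (((L : ℝ) + 2) / 4) with h2 | h2
    · exact ⟨qa, hqa, by linarith⟩
    · exact ⟨q0, hq0, by linarith⟩
  · have T1 := mgDist_triangle hG (γ s) (γ b) qb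
    have T2 := mgDist_triangle hG (γ s) (γ τ3) q3
    rw [hγ.2 s hs b ⟨hab, le_rfl⟩, abs_sub_comm, abs_of_nonneg (by linarith [hs.2])] at T1
    rw [hγ.2 s hs _ ht3, abs_of_nonneg (by linarith [hs.1])] at T2
    rcases le_total (b - s) (((L : ℝ) + 2) / 4) with h2 | h2
    · exact ⟨qb, hqb, by linarith⟩
    · exact ⟨q3, hq3, by linarith⟩

end FanMain

set_option linter.unusedSectionVars false

section FanPairs
variable {n c g L m : ℕ} {v : ℕ → ℕ}

lemma FanHyp.dist_path (h : FanHyp n c g L m v) {i k : ℕ} (hi : 1 ≤ i) (hik : i ≤ k) (hk : k < c) :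
    ((fanG n c m v).dist (h.x i) (h.x k) : ℝ) ≤ (k : ℝ) - i := by
  induction k, hik using Nat.le_induction with
  | base => simp
  | succ k hik ih =>
    have h1 := ih (by omega)
    have h2 : ((fanG n c m v).dist (h.x k) (h.x (k+1)) : ℝ) = 1 := by
      exact_mod_cast SimpleGraph.dist_eq_one_iff_adj.mpr (h.adj_succ (by omega) hk)
    have h3 : ((fanG n c m v).dist (h.x i) (h.x (k+1)) : ℝ) ≤
        (fanG n c m v).dist (h.x i) (h.x k) + (fanG n c m v).dist (h.x k) (h.x (k+1)) := by
      exact_mod_cast h.conn.dist_triangle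
    push_cast
    linarith

lemma FanHyp.dist_path' (h : FanHyp n c g L m v) {i k : ℕ} (hi : 1 ≤ i) (hik : i ≤ k) (hk : k < c) :
    ((fanG n c m v).dist (h.x k) (h.x i) : ℝ) ≤ (k : ℝ) - i := by
  rw [SimpleGraph.dist_comm]; exact h.dist_path hi hik hk

/-- segment position data -/
def FanHyp.Seg (h : FanHyp n c g L m v) (j : ℕ) (x : MGPoint (fanG n c m v)) : Prop :=
  ∃ (i : ℕ) (t : ℝ), v j ≤ i ∧ i < v (j+1) ∧ Canon x (h.x i) (h.x (i+1)) t

lemma FanHyp.L_ge (h : FanHyp n c g L m v) : (5:ℝ) ≤ L := by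
  have h1 := h.lo 0 h.hm
  have h2 := h.hi 0 h.hm
  have := h.hg
  have : 5 ≤ L := by omega
  exact_mod_cast this

lemma FanHyp.seg_D (h : FanHyp n c g L m v) {j : ℕ} (hj : j < m) {x : MGPoint (fanG n c m v)}
    {i : ℕ} {t : ℝ} (h1 : v j ≤ i) (h2 : i < v (j+1)) (hc : Canon x (h.x i) (h.x (i+1)) t) :
    mgVDist (fanG n c m v) (h.x (v j)) x ≤ i + t - v j ∧
    mgVDist (fanG n c m v) (h.x (v (j+1))) x ≤ v (j+1) - i - t ∧
    mgVDist (fanG n c m v) (h.x 0) x ≤ 1 + (i + t - v j) ∧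
    mgVDist (fanG n c m v) (h.x 0) x ≤ 1 + (v (j+1) - i - t) := by
  have l1 := h.pos hj.le
  have l2 := h.lt (show j + 1 ≤ m from hj)
  have a1 := hc.D1 (h.x (v j))
  have a2 := hc.D2 (h.x (v (j+1)))
  have b1 := h.dist_path l1 h1 (by omega)
  have b2 := h.dist_path' (i := i + 1) (k := v (j+1)) (by omega) (by omega) l2
  have c1 := mgVDist_le_add h.conn (h.x 0) (h.x (v j)) x
  have c2 := mgVDist_le_add h.conn (h.x 0) (h.x (v (j+1))) x
  rw [h.dist_hub hj.le] at c1
  rw [h.dist_hub (show j + 1 ≤ m from hj)] at c2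
  push_cast at b2
  refine ⟨?_, ?_, ?_, ?_⟩ <;> linarith

lemma FanHyp.v_locate (h : FanHyp n c g L m v) (i : ℕ) (hi : 1 ≤ i) (hic : i + 1 < c) :
    ∃ j < m, v j ≤ i ∧ i < v (j+1) := by
  have key : ∀ k, i < v k → ∃ j < k, v j ≤ i ∧ i < v (j+1) := by
    intro k
    induction k with
    | zero => intro hk; rw [h.v0] at hk; omega
    | succ k ih =>
      intro hk
      rcases le_or_gt (v k) i with h1 | h1
      · exact ⟨k, by omega, h1, hk⟩
      · obtain ⟨j, h2, h3⟩ := ih h1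
        exact ⟨j, by omega, h3⟩
  exact key m (by have := h.vm; omega)

lemma FanHyp.classify (h : FanHyp n c g L m v) (x : MGPoint (fanG n c m v)) :
    ((∀ j ≤ m, h.Rt j x) ∧ mgVDist (fanG n c m v) (h.x 0) x ≤ 1) ∨
    (∃ j ≤ m, h.Rt j x ∧ h.Lf j x) ∨
    (∃ j < m, h.Lf j x ∧ h.Rt (j+1) x ∧ h.Seg j x) := by
  have hL := h.L_ge
  obtain ⟨u, w, t, hc⟩ := canon_exists x
  have ht0 := hc.2.1
  have ht1 := hc.2.2.1
  obtain ⟨h1, ⟨h2, h3⟩ | ⟨h2, h3, h4⟩⟩ := hc.1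
  · have eu : h.x 0 = u := Fin.ext (by rw [h.x_0, h2])
    have dH : mgVDist (fanG n c m v) (h.x 0) x ≤ t := by
      have := hc.D1 (h.x 0)
      rw [eu, SimpleGraph.dist_self] at this
      rw [eu]; simpa using this
    by_cases hl : c ≤ w.val
    · left
      refine ⟨fun j hj => ⟨?_, ?_⟩, dH.trans ht1⟩
      · rw [hc.interp, cut_0 _ u h2, cut_leaf _ w hl (by omega)]
        linarith
      · unfold FanHyp.gate
        have := mgVDist_le_add h.conn (h.x (v j)) (h.x 0) x
        rw [SimpleGraph.dist_comm, h.dist_hub hj] at this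
        linarith
    · rcases h3 with h3 | ⟨j, hj, h3⟩
      · exact absurd h3 hl
      right; left
      have ew : h.x (v j) = w := Fin.ext (by rw [h.x_val' (h.lt hj), h3])
      have e : mgInterp (cut n c (v j)) x = 0 := by
        rw [hc.interp, cut_0 _ u h2, cut_eq _ w (by omega) (by omega) h3]; ring
      have hgate : h.gate j x := by
        unfold FanHyp.gate
        have := hc.D2 (h.x (v j))
        rw [ew, SimpleGraph.dist_self] at this
        rw [ew]
        push_cast at this
        linarith
      exact ⟨j, hj, ⟨e.le, hgate⟩, ⟨e.ge, hgate⟩⟩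
  · right; right
    obtain ⟨j, hj, h5, h6⟩ := h.v_locate u.val h2 (by omega)
    have eu : h.x u.val = u := h.x_self u
    have ew : h.x (u.val + 1) = w := by rw [← h3]; exact h.x_self w
    have hc' : Canon x (h.x u.val) (h.x (u.val+1)) t := by rw [eu, ew]; exact hc
    obtain ⟨d1, d2, d3, d4⟩ := h.seg_D hj h5 h6 hc'
    have hhi : (v (j+1) : ℝ) + 2 ≤ v j + L := by exact_mod_cast h.hi j hj
    refine ⟨j, hj, ⟨?_, ?_⟩, ⟨?_, ?_⟩, u.val, t, h5, h6, hc'⟩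
    · rw [hc.interp, cut_gt (v j) w h4 (by omega) (by omega)]
      have : 0 ≤ cut n c (v j) u := by
        rcases h5.eq_or_lt with h7 | h7
        · exact (cut_eq _ u (by omega) (by omega) h7.symm).ge
        · rw [cut_gt _ u (by omega) (by omega) h7]; norm_num
      have := mul_nonneg (sub_nonneg.mpr ht1) this
      linarith
    · unfold FanHyp.gate; linarith
    · rw [hc.interp, cut_lt (v (j+1)) u (by omega) (by omega) h6]
      have : cut n c (v (j+1)) w ≤ 0 := by
        rcases (show w.val ≤ v (j+1) by omega).eq_or_lt with h7 | h7
        · exact (cut_eq _ w (by omega) (by omega) h7).le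
        · rw [cut_lt _ w (by omega) (by omega) h7]; norm_num
      have := mul_nonneg ht0 (neg_nonneg.mpr this)
      linarith
    · unfold FanHyp.gate; linarith

lemma FanHyp.same_seg (h : FanHyp n c g L m v) {j : ℕ} (hj : j < m) {x y : MGPoint (fanG n c m v)}
    {i i' : ℕ} {t t' : ℝ} (h1 : v j ≤ i) (h2 : i < v (j+1)) (hc : Canon x (h.x i) (h.x (i+1)) t)
    (h1' : v j ≤ i') (h2' : i' < v (j+1)) (hc' : Canon y (h.x i') (h.x (i'+1)) t')
    (hle : (i:ℝ) + t ≤ i' + t') (hii : i ≤ i') :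
    mgDist (fanG n c m v) x y ≤ (L : ℝ) / 2 + 1 := by
  obtain ⟨d1, d2, d3, d4⟩ := h.seg_D hj h1 h2 hc
  obtain ⟨e1, e2, e3, e4⟩ := h.seg_D hj h1' h2' hc'
  have hhi : (v (j+1) : ℝ) + 2 ≤ v j + L := by exact_mod_cast h.hi j hj
  have A := mgDist_le_vdist h.conn (h.x 0) x y
  have B : mgDist (fanG n c m v) x y ≤ (i' + t') - (i + t) := by
    rcases hii.eq_or_lt with rfl | hlt
    · have := hc.same hc'
      rw [abs_sub_comm, abs_of_nonneg (by linarith)] at this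
      linarith
    · have l1 := h.pos hj.le
      have l2 := h.lt (show j + 1 ≤ m from hj)
      have a1 := hc.D2 (h.x (i+1))
      have a2 := hc'.D1 (h.x (i+1))
      have b1 := h.dist_path (i := i+1) (k := i') (by omega) hlt (by omega)
      have C := mgDist_le_vdist h.conn (h.x (i+1)) x y
      rw [SimpleGraph.dist_self] at a1
      push_cast at a1 b1
      linarith
  linarith

lemma FanHyp.pair (h : FanHyp n c g L m v) (x y : MGPoint (fanG n c m v)) :
    mgDist (fanG n c m v) x y ≤ (L : ℝ) / 2 + 1 ∨
    (∃ j1 j2, j1 ≤ j2 ∧ j2 ≤ m ∧ h.Rt j1 x ∧ h.Lf j2 y) ∨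
    (∃ j1 j2, j1 ≤ j2 ∧ j2 ≤ m ∧ h.Rt j1 y ∧ h.Lf j2 x) := by
  have hL := h.L_ge
  rcases h.classify x with ⟨hx, dx⟩ | ⟨j, hj, r, l⟩ | ⟨j, hj, l, r, i, t, s1, s2, s3⟩ <;>
  rcases h.classify y with ⟨hy, dy⟩ | ⟨j', hj', r', l'⟩ | ⟨j', hj', l', r', i', t', s1', s2', s3'⟩
  · left
    have A := mgDist_le_vdist h.conn (h.x 0) x y
    linarith
  · exact Or.inr (Or.inl ⟨j', j', le_rfl, hj', hx j' hj', l'⟩)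
  · exact Or.inr (Or.inl ⟨j', j', le_rfl, hj'.le, hx j' hj'.le, l'⟩)
  · exact Or.inr (Or.inr ⟨j, j, le_rfl, hj, hy j hj, l⟩)
  · rcases le_total j j' with hh | hh
    · exact Or.inr (Or.inl ⟨j, j', hh, hj', r, l'⟩)
    · exact Or.inr (Or.inr ⟨j', j, hh, hj, r', l⟩)
  · rcases le_or_gt j j' with hh | hh
    · exact Or.inr (Or.inl ⟨j, j', hh, hj'.le, r, l'⟩)
    · exact Or.inr (Or.inr ⟨j' + 1, j, hh, hj, r', l⟩)
  · exact Or.inr (Or.inr ⟨j, j, le_rfl, hj.le, hy j hj.le, l⟩)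
  · rcases le_or_gt j' j with hh | hh
    · exact Or.inr (Or.inr ⟨j', j, hh, hj.le, r', l⟩)
    · exact Or.inr (Or.inl ⟨j + 1, j', hh, hj', r, l'⟩)
  · rcases lt_trichotomy j j' with hh | hh | hh
    · exact Or.inr (Or.inl ⟨j + 1, j', hh, hj'.le, r, l'⟩)
    · subst hh
      left
      have q1 := s3.2.1
      have q2 := s3.2.2.1
      have q1' := s3'.2.1
      have q2' := s3'.2.2.1
      have sym := mgDist_comm h.conn x y
      rcases lt_trichotomy i i' with hi | hi | hi
      · have : (i:ℝ) + 1 ≤ i' := by exact_mod_cast hi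
        exact h.same_seg hj s1 s2 s3 s1' s2' s3' (by linarith) hi.le
      · subst hi
        rcases le_total t t' with ht | ht
        · exact h.same_seg hj s1 s2 s3 s1' s2' s3' (by linarith) le_rfl
        · rw [sym]
          exact h.same_seg hj s1' s2' s3' s1 s2 s3 (by linarith) le_rfl
      · have : (i':ℝ) + 1 ≤ i := by exact_mod_cast hi
        rw [sym]
        exact h.same_seg hj s1' s2' s3' s1 s2 s3 (by linarith) hi.le
    · exact Or.inr (Or.inr ⟨j' + 1, j, hh, hj.le, r', l⟩)

lemma FanHyp.sideThin (h : FanHyp n c g L m v) : SideThin (fanG n c m v) (((L : ℝ) + 2) / 4) := by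
  intro a b γ Q hγ hQa hQb hQ1 hQ2
  rcases h.pair (γ a) (γ b) with h1 | ⟨j1, j2, hj, hj2, hx, hy⟩ | ⟨j1, j2, hj, hj2, hx, hy⟩
  · intro s hs
    have hab := hγ.1
    obtain ⟨qa, hqa, da⟩ := hQa
    obtain ⟨qb, hqb, db⟩ := hQb
    have T1 := mgDist_triangle h.conn (γ s) (γ a) qa
    have T2 := mgDist_triangle h.conn (γ s) (γ b) qb
    rw [hγ.2 s hs a ⟨le_rfl, hab⟩, abs_of_nonneg (by linarith [hs.1])] at T1
    rw [hγ.2 s hs b ⟨hab, le_rfl⟩, abs_sub_comm, abs_of_nonneg (by linarith [hs.2])] at T2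
    rw [hγ.2 a ⟨le_rfl, hab⟩ b ⟨hab, le_rfl⟩, abs_sub_comm, abs_of_nonneg (by linarith)] at h1
    rcases le_total (s - a) (((L : ℝ) + 2) / 4) with h2 | h2
    · exact ⟨qa, hqa, by linarith⟩
    · exact ⟨qb, hqb, by linarith⟩
  · exact h.oriented hγ hj hj2 hx hy Q hQa hQb hQ1
  · intro s hs
    have := h.oriented hγ.reverse hj hj2 (by simpa using hx) (by simpa using hy) Q
      (by simpa using hQb) (by simpa using hQa)
      (by
        intro f hf q1 q2
        simp only [neg_neg] at q1 q2
        exact hQ2 f hf q2 q1) (-s) ⟨by linarith [hs.2], by linarith [hs.1]⟩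
    simpa using this

lemma FanHyp.upper (h : FanHyp n c g L m v) : Agcn g c n ≤ ((L : ℝ) + 2) / 4 := by
  apply Agcn_upper g c n h.hg _ h.mem_class
  exact hypDelta_le_of_thin h.conn (by positivity) h.sideThin

/-- choice of the spokes -/
lemma fan_exists (g c n m e : ℕ) (hg : 5 ≤ g) (hcn : c ≤ n) (hm : 2 ≤ m)
    (h1 : 2 + m * (g - 2) ≤ c) (h2 : c ≤ 2 + m * (g - 2) + (m - 1) * e) :
    Agcn g c n ≤ ((g : ℝ) + e + 2) / 4 := by
  obtain ⟨X, rfl⟩ : ∃ X, c = 2 + m * (g - 2) + X := ⟨c - (2 + m * (g-2)), by omega⟩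
  have hX : X ≤ (m - 1) * e := by omega
  have H : FanHyp n (2 + m * (g - 2) + X) g (g + e) m (fun j => 1 + j * (g - 2) + min ((j - 1) * e) X) := by
    have hstep : ∀ j, (j + 1) * (g - 2) = j * (g - 2) + (g - 2) := fun j => by ring
    have hstep2 : ∀ j, (j + 1 - 1) * e ≤ (j - 1) * e + e ∧ (j - 1) * e ≤ (j + 1 - 1) * e := by
      intro j
      rcases j with _ | j
      · simp
      · simp only [Nat.add_sub_cancel]
        have : (j + 1) * e = j * e + e := by ring
        omega
    refine ⟨hg, hcn, by omega, by simp, ?_, ?_, ?_, ?_⟩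
    · simp; omega
    · simp only [min_eq_right hX]; omega
    · intro j _
      have a := hstep j
      have b := hstep2 j
      omega
    · intro j _
      have a := hstep j
      have b := hstep2 j
      omega
  have := H.upper
  push_cast at this
  exact this

end FanPairs

/-- Theorem (cotaA): bounds for `A(g,c,n)` for v-admissible triplets with `g ≥ 5`. -/
theorem Agcn_bounds (g c n : ℕ) (hg : 5 ≤ g) (hgc : g ≤ c) (hcn : c ≤ n)
    (hadm : ∃ G : SimpleGraph (Fin n), memGclass g c G) :
    (g : ℝ) / 4 ≤ Agcn g c n ∧
    (∀ s : ℕ, s ≤ g - 3 → c = 2 * g - 2 + s → Agcn g c n ≤ ((g : ℝ) + 2 + (s : ℝ)) / 4) ∧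
    (∀ r : ℕ, 1 ≤ r → Even g → c = 2 * g - 2 + r * (g - 2) →
      Agcn g c n ≤ ((g : ℝ) + 2) / 4) ∧
    (∀ r : ℕ, 1 ≤ r → Odd g → 2 * g - 2 + r * (g - 2) ≤ c → c ≤ 2 * g - 1 + r * (g - 2) →
      Agcn g c n ≤ ((g : ℝ) + 3) / 4) ∧
    (∀ r s : ℕ, 1 ≤ r → Even g → 2 * g - 2 + r * (g - 2) < c →
      c ≤ 2 * g - 2 + r * (g - 2) + 2 * (r + 1) * (s + 1) →
      Agcn g c n ≤ ((g : ℝ) + 4 + 2 * (s : ℝ)) / 4) ∧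
    (∀ r s : ℕ, 1 ≤ r → Odd g → 2 * g - 1 + r * (g - 2) < c →
      c ≤ 2 * g - 2 + r * (g - 2) + 2 * (r + 1) * (s + 1) →
      Agcn g c n ≤ ((g : ℝ) + 5 + 2 * (s : ℝ)) / 4) := by
  have hmul : ∀ r : ℕ, 2 + (r + 2) * (g - 2) = 2 * g - 2 + r * (g - 2) := by
    intro r
    have : (r + 2) * (g - 2) = r * (g - 2) + 2 * (g - 2) := by ring
    omega
  refine ⟨Agcn_lower g c n hg hadm, ?_, ?_, ?_, ?_, ?_⟩
  · intro s _ hc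
    refine (fan_exists g c n 2 s hg hcn le_rfl (by omega) (by omega)).trans ?_
    linarith
  · intro r _ _ hc
    have := hmul r
    refine (fan_exists g c n (r + 2) 0 hg hcn (by omega) (by omega) (by omega)).trans ?_
    push_cast
    linarith
  · intro r _ _ hc1 hc2
    have := hmul r
    refine (fan_exists g c n (r + 2) 1 hg hcn (by omega) (by omega) (by omega)).trans ?_
    push_cast
    linarith
  · intro r s _ _ hc1 hc2
    have := hmul r
    have h2 : (r + 2 - 1) * (2 * (s + 1)) = 2 * (r + 1) * (s + 1) := by
      rw [show r + 2 - 1 = r + 1 by omega]; ring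
    refine (fan_exists g c n (r + 2) (2 * (s + 1)) hg hcn (by omega) (by omega) (by omega)).trans ?_
    push_cast
    linarith
  · intro r s _ _ hc1 hc2
    have := hmul r
    have h2 : (r + 2 - 1) * (2 * (s + 1)) = 2 * (r + 1) * (s + 1) := by
      rw [show r + 2 - 1 = r + 1 by omega]; ring
    refine (fan_exists g c n (r + 2) (2 * (s + 1)) hg hcn (by omega) (by omega) (by omega)).trans ?_
    push_cast
    linarith
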